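/- arXiv:math/0703668 — 3 statements merged into one kernel-verified Lean document; each statement's English description precedes it below -/
import Mathlib

section
/- There is an absolute constant C ≥ 0 with the following property: for every real number K ≥ 2, every n ≥ 1, and every nonempty set A ⊆ F_2^n with |A + A| ≤ K·|A|, there exists an affine subspace V ⊆ F_2^n such that A ⊆ V and |V| ≤ 2^(2K + C·√K·log₂ K)·|A|. -/
open Finset Pointwise

abbrev F2 (n : ℕ) := Fin n → ZMod 2

/-- The standard basis vector `e i` of `F_2^n`. -/
def stdBasis {n : ℕ} (i : Fin n) : F2 n := Pi.single i 1

/-- `A` is a downset: whenever `x i = 0` and `x + e i ∈ A`, also `x ∈ A`. -/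
def IsDownset {n : ℕ} (A : Finset (F2 n)) : Prop :=
  ∀ x : F2 n, ∀ i : Fin n, x i = 0 → x + stdBasis i ∈ A → x ∈ A

/-- `A` is shift-minimal: whenever `i < j`, `x i = x j = 0` and `x + e j ∈ A`,
also `x + e i ∈ A`. -/
def IsShiftMinimal {n : ℕ} (A : Finset (F2 n)) : Prop :=
  ∀ x : F2 n, ∀ i j : Fin n, i < j → x i = 0 → x j = 0 →
    x + stdBasis j ∈ A → x + stdBasis i ∈ A

/-- The Hamming ball of radius `r` in `F_2^n`. -/
def hamBall (n r : ℕ) : Finset (F2 n) := Finset.univ.filter fun x => hammingNorm x ≤ r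

section Compression

variable {ι : Type*}

theorem zmod_two_eq_one_of_ne_zero {a : ZMod 2} (h : a ≠ 0) : a = 1 := by
  revert h; revert a; decide

theorem add_add_self_cancel (x u : ι → ZMod 2) : x + u + u = x := by
  rw [add_assoc, ZModModule.add_self, add_zero]

/-- `A` is stable under all compressions towards `x k = 0` with `k ∉ S` along vectors supported
on `insert k S`. -/
def IsStable (S : Finset ι) (A : Finset (ι → ZMod 2)) : Prop :=
  ∀ k ∉ S, ∀ u : ι → ZMod 2, u k = 1 → (∀ i ∉ S, i ≠ k → u i = 0) →
    ∀ x ∈ A, x k = 1 → x + u ∈ A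

theorem IsStable.mem_of_eq {S : Finset ι} {A : Finset (ι → ZMod 2)} (h : IsStable S A)
    {k : ι} (hk : k ∉ S) {x y : ι → ZMod 2} (hx : x ∈ A) (hxk : x k = 1) (hyk : y k = 0)
    (hxy : ∀ i ∉ S, i ≠ k → x i = y i) : y ∈ A := by
  have := h k hk (x + y) (by simp [hxk, hyk]) (fun i hi hik => by
    rw [Pi.add_apply, hxy i hi hik, ZModModule.add_self]) x hx hxk
  rwa [← add_assoc, ZModModule.add_self, zero_add] at this

variable [Fintype ι]

/-- The map moving `x` to `x + u` when `x k = 1` and the position `x + u` is free in `A`. -/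
def compressMap (k : ι) (u : ι → ZMod 2) (A : Finset (ι → ZMod 2)) (x : ι → ZMod 2) :
    ι → ZMod 2 :=
  if x k = 1 ∧ x + u ∉ A then x + u else x

/-- The compression of `A` along `u` towards the hyperplane `x k = 0`. -/
def compress (k : ι) (u : ι → ZMod 2) (A : Finset (ι → ZMod 2)) :
    Finset (ι → ZMod 2) :=
  A.image (compressMap k u A)

theorem compressMap_injOn {k : ι} {u : ι → ZMod 2} (A : Finset (ι → ZMod 2)) :
    Set.InjOn (compressMap k u A) A := by
  intro x hx y hy hxy
  simp only [Finset.mem_coe] at hx hy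
  unfold compressMap at hxy
  split_ifs at hxy with h1 h2 h2
  · exact add_right_cancel hxy
  · exact absurd (hxy ▸ hy) h1.2
  · exact absurd (hxy ▸ hx) h2.2
  · exact hxy

theorem card_compress (k : ι) (u : ι → ZMod 2) (A : Finset (ι → ZMod 2)) :
    (compress k u A).card = A.card :=
  Finset.card_image_of_injOn (compressMap_injOn A)

theorem mem_compress_of_eq_zero {k : ι} {u : ι → ZMod 2} (hu : u k = 1)
    {A : Finset (ι → ZMod 2)} {x : ι → ZMod 2} (hx : x k = 0) :
    x ∈ compress k u A ↔ x ∈ A ∨ x + u ∈ A := by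
  simp only [compress, Finset.mem_image]
  constructor
  · rintro ⟨y, hy, rfl⟩
    unfold compressMap
    split_ifs with h
    · right; rwa [add_add_self_cancel]
    · exact Or.inl hy
  · intro h
    by_cases hxA : x ∈ A
    · exact ⟨x, hxA, by simp [compressMap, hx]⟩
    · refine ⟨x + u, h.resolve_left hxA, ?_⟩
      simp [compressMap, add_add_self_cancel, hx, hu, hxA]

theorem mem_compress_of_eq_one {k : ι} {u : ι → ZMod 2} (hu : u k = 1)
    {A : Finset (ι → ZMod 2)} {x : ι → ZMod 2} (hx : x k = 1) :
    x ∈ compress k u A ↔ x ∈ A ∧ x + u ∈ A := by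
  simp only [compress, Finset.mem_image]
  constructor
  · rintro ⟨y, hy, rfl⟩
    unfold compressMap at hx ⊢
    split_ifs at hx ⊢ with h
    · rw [Pi.add_apply, h.1, hu] at hx
      exact absurd hx (by decide)
    · exact ⟨hy, by_contra fun h' => h ⟨hx, h'⟩⟩
  · rintro ⟨h1, h2⟩
    exact ⟨x, h1, by simp [compressMap, h2]⟩

theorem compress_add_compress_subset {k : ι} {u : ι → ZMod 2} (hu : u k = 1)
    (A : Finset (ι → ZMod 2)) :
    compress k u A + compress k u A ⊆ compress k u (A + A) := by
  intro z hz
  obtain ⟨x, hx, y, hy, rfl⟩ := Finset.mem_add.1 hz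
  have mixed : ∀ x y : ι → ZMod 2, x k = 1 → y k = 0 → x ∈ compress k u A →
      y ∈ compress k u A → x + y ∈ compress k u (A + A) := by
    intro x y hxk hyk hx hy
    rw [mem_compress_of_eq_one hu hxk] at hx
    rw [mem_compress_of_eq_zero hu hyk] at hy
    rw [mem_compress_of_eq_one hu (by simp [hxk, hyk])]
    rcases hy with hy | hy
    · exact ⟨Finset.add_mem_add hx.1 hy, by
        rw [add_right_comm]; exact Finset.add_mem_add hx.2 hy⟩
    · refine ⟨?_, by rw [add_assoc]; exact Finset.add_mem_add hx.1 hy⟩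
      have := Finset.add_mem_add hx.2 hy
      rwa [add_add_add_comm, ZModModule.add_self, add_zero] at this
  by_cases hxk : x k = 0 <;> by_cases hyk : y k = 0
  · rw [mem_compress_of_eq_zero hu hxk] at hx
    rw [mem_compress_of_eq_zero hu hyk] at hy
    rw [mem_compress_of_eq_zero hu (by simp [hxk, hyk])]
    rcases hx with hx | hx <;> rcases hy with hy | hy <;> have := Finset.add_mem_add hx hy
    · exact Or.inl this
    · rw [← add_assoc] at this; exact Or.inr this
    · rw [add_right_comm] at this; exact Or.inr this
    · rw [add_add_add_comm, ZModModule.add_self, add_zero] at this; exact Or.inl this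
  · exact add_comm y x ▸ mixed y x (zmod_two_eq_one_of_ne_zero hyk) hxk hy hx
  · exact mixed x y (zmod_two_eq_one_of_ne_zero hxk) hyk hx hy
  · have hxk := zmod_two_eq_one_of_ne_zero hxk
    have hyk := zmod_two_eq_one_of_ne_zero hyk
    rw [mem_compress_of_eq_one hu hxk] at hx
    rw [mem_compress_of_eq_one hu hyk] at hy
    rw [mem_compress_of_eq_zero hu (by simp only [Pi.add_apply, hxk, hyk]; decide)]
    exact Or.inl (Finset.add_mem_add hx.1 hy.1)

theorem card_compress_add_compress_le {k : ι} {u : ι → ZMod 2} (hu : u k = 1)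
    (A : Finset (ι → ZMod 2)) :
    (compress k u A + compress k u A).card ≤ (A + A).card :=
  (Finset.card_le_card (compress_add_compress_subset hu A)).trans_eq (card_compress k u _)

variable [DecidableEq ι]

/-- `A` contains the coordinate subspace on `S` and all standard basis vectors. -/
def ContainsFrame (S : Finset ι) (A : Finset (ι → ZMod 2)) : Prop :=
  (∀ x : ι → ZMod 2, (∀ i ∉ S, x i = 0) → x ∈ A) ∧ ∀ i, Pi.single i 1 ∈ A

theorem ContainsFrame.compress {S : Finset ι} {A : Finset (ι → ZMod 2)} (h : ContainsFrame S A)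
    {k : ι} (hk : k ∉ S) {u : ι → ZMod 2} (hu : u k = 1) (huS : ∀ i ∉ S, i ≠ k → u i = 0) :
    ContainsFrame S (compress k u A) := by
  refine ⟨fun x hx => (mem_compress_of_eq_zero hu (hx k hk)).2 (Or.inl (h.1 x hx)), fun i => ?_⟩
  rcases eq_or_ne i k with rfl | hik
  · rw [mem_compress_of_eq_one hu (by simp)]
    refine ⟨h.2 i, h.1 _ fun j hj => ?_⟩
    rcases eq_or_ne j i with rfl | hji
    · simp only [Pi.add_apply, Pi.single_eq_same, hu]; decide
    · simp [hji, huS j hj hji]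
  · rw [mem_compress_of_eq_zero hu (by simp [hik.symm])]
    exact Or.inl (h.2 i)

/-- The number of nonzero coordinates of `x` outside `S`. -/
def weightOutside (S : Finset ι) (x : ι → ZMod 2) : ℕ :=
  (Finset.univ.filter fun i => i ∉ S ∧ x i ≠ 0).card

theorem weightOutside_add_lt {S : Finset ι} {k : ι} (hk : k ∉ S) {u : ι → ZMod 2} (hu : u k = 1)
    (huS : ∀ i ∉ S, i ≠ k → u i = 0) {x : ι → ZMod 2} (hx : x k = 1) :
    weightOutside S (x + u) < weightOutside S x := by
  refine Finset.card_lt_card (Finset.ssubset_iff_of_subset ?_ |>.2 ⟨k, by simp [hk, hx], ?_⟩)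
  · intro i hi
    simp only [Finset.mem_filter, Finset.mem_univ, true_and, Pi.add_apply] at hi ⊢
    refine ⟨hi.1, ?_⟩
    rcases eq_or_ne i k with rfl | hik
    · simp [hx]
    · simpa [huS i hi.1 hik] using hi.2
  · have : (1 + 1 : ZMod 2) = 0 := by decide
    simp [hx, hu, this]

theorem sum_weightOutside_compress_lt {S : Finset ι} {k : ι} (hk : k ∉ S) {u : ι → ZMod 2}
    (hu : u k = 1) (huS : ∀ i ∉ S, i ≠ k → u i = 0) {A : Finset (ι → ZMod 2)}
    {x : ι → ZMod 2} (hxA : x ∈ A) (hx : x k = 1) (hxu : x + u ∉ A) :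
    ∑ y ∈ compress k u A, weightOutside S y < ∑ y ∈ A, weightOutside S y := by
  rw [compress, Finset.sum_image (compressMap_injOn A)]
  refine Finset.sum_lt_sum (fun y _ => ?_) ⟨x, hxA, ?_⟩
  · unfold compressMap
    split_ifs with h
    · exact (weightOutside_add_lt hk hu huS h.1).le
    · exact le_rfl
  · rw [compressMap, if_pos ⟨hx, hxu⟩]
    exact weightOutside_add_lt hk hu huS hx

theorem exists_isStable (S : Finset ι) (A : Finset (ι → ZMod 2)) (h : ContainsFrame S A) :
    ∃ B : Finset (ι → ZMod 2), B.card = A.card ∧ (B + B).card ≤ (A + A).card ∧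
      ContainsFrame S B ∧ IsStable S B := by
  induction hm : ∑ y ∈ A, weightOutside S y using Nat.strong_induction_on generalizing A with
  | _ m ih =>
    by_cases hst : IsStable S A
    · exact ⟨A, rfl, le_rfl, h, hst⟩
    · unfold IsStable at hst
      push Not at hst
      obtain ⟨k, hk, u, hu, huS, x, hxA, hx, hxu⟩ := hst
      obtain ⟨B, hB1, hB2, hB3⟩ := ih _
        (hm ▸ sum_weightOutside_compress_lt hk hu huS hxA hx hxu) _ (h.compress hk hu huS) rfl
      exact ⟨B, hB1.trans (card_compress k u A),
        hB2.trans (card_compress_add_compress_le hu A), hB3⟩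

theorem IsStable.exists_mem_eq_zero {S : Finset ι} {A : Finset (ι → ZMod 2)}
    (h : IsStable S A) {i j : ι} {x : ι → ZMod 2}
    (hx : x ∈ A) (hxi : x i = 1) (hxj : x j = 1) :
    ∃ y ∈ A, y i = 1 ∧ y j = 1 ∧ ∀ k ∉ S, k ≠ i → k ≠ j → y k = 0 := by
  induction hm : weightOutside S x using Nat.strong_induction_on generalizing x with
  | _ m ih =>
    by_cases hz : ∀ k ∉ S, k ≠ i → k ≠ j → x k = 0
    · exact ⟨x, hx, hxi, hxj, hz⟩
    · push Not at hz
      obtain ⟨k, hk, hki, hkj, hxk⟩ := hz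
      have hu : ∀ l ∉ S, l ≠ k → (Pi.single k 1 : ι → ZMod 2) l = 0 :=
        fun l _ hl => Pi.single_eq_of_ne hl _
      have hxk := zmod_two_eq_one_of_ne_zero hxk
      exact ih _ (hm ▸ weightOutside_add_lt hk (by simp) hu hxk)
        (h k hk (Pi.single k 1) (by simp) hu x hx hxk)
        (by simp [hxi, hki.symm]) (by simp [hxj, hkj.symm]) rfl

theorem IsStable.containsFrame_insert {S : Finset ι} {A : Finset (ι → ZMod 2)}
    (h : IsStable S A) (hA : ContainsFrame S A) {i j : ι} (hj : j ∉ S)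
    (hij : i ≠ j) {x : ι → ZMod 2} (hx : x ∈ A) (hxi : x i = 1) (hxj : x j = 1) :
    ContainsFrame (insert i S) A := by
  obtain ⟨y, hyA, hyi, hyj, hy⟩ := h.exists_mem_eq_zero hx hxi hxj
  refine ⟨fun z hz => ?_, hA.2⟩
  have hz' : ∀ k ∉ S, k ≠ i → z k = 0 := fun k hk hki => hz k (by simp [hk, hki])
  by_cases hzi : z i = 0
  · refine hA.1 z fun k hk => ?_
    rcases eq_or_ne k i with rfl | hki
    · exact hzi
    · exact hz' k hk hki
  · refine h.mem_of_eq hj hyA hyj (hz' j hj hij.symm) fun k hk hkj => ?_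
    rcases eq_or_ne k i with rfl | hki
    · rw [hyi, zmod_two_eq_one_of_ne_zero hzi]
    · rw [hy k hk hki hkj, hz' k hk hki]

theorem exists_weightOutside_le_one (S : Finset ι) (A : Finset (ι → ZMod 2))
    (h : ContainsFrame S A) :
    ∃ (T : Finset ι) (B : Finset (ι → ZMod 2)), B.card = A.card ∧ (B + B).card ≤ (A + A).card ∧
      ContainsFrame T B ∧ ∀ x ∈ B, weightOutside T x ≤ 1 := by
  induction hm : Sᶜ.card using Nat.strong_induction_on generalizing S A with
  | _ m ih =>
    obtain ⟨B, hB1, hB2, hB3, hst⟩ := exists_isStable S A h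
    by_cases hw : ∀ x ∈ B, weightOutside S x ≤ 1
    · exact ⟨S, B, hB1, hB2, hB3, hw⟩
    · push Not at hw
      obtain ⟨x, hx, hwx⟩ := hw
      obtain ⟨i, hi, j, hj, hij⟩ := Finset.one_lt_card.1 hwx
      simp only [Finset.mem_filter, Finset.mem_univ, true_and] at hi hj
      have hlt : (insert i S)ᶜ.card < m := by
        rw [← hm, Finset.compl_insert]
        exact Finset.card_erase_lt_of_mem (by simpa using hi.1)
      obtain ⟨T, D, hD1, hD2, hD3⟩ := ih _ hlt (insert i S) B
        (hst.containsFrame_insert hB3 hj.1 hij hx (zmod_two_eq_one_of_ne_zero hi.2)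
          (zmod_two_eq_one_of_ne_zero hj.2)) rfl
      exact ⟨T, D, hD1.trans hB1, hD2.trans hB2, hD3⟩

theorem card_mul_le_two_mul_card_add {S : Finset ι} {A : Finset (ι → ZMod 2)}
    (h : ContainsFrame S A) (hw : ∀ x ∈ A, weightOutside S x ≤ 1) :
    A.card * (Sᶜ.card - 1) ≤ (A + A).card * 2 := by
  refine Finset.card_mul_le_card_mul
    (fun x z => ∃ j, j ∉ S ∧ x j = 0 ∧ z = x + Pi.single j 1) (fun x hx => ?_) (fun z _ => ?_)
  · have hsub : ((Finset.univ.filter fun j => j ∉ S ∧ x j = 0).image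
        fun j => x + Pi.single j 1) ⊆ Finset.bipartiteAbove
          (fun x z => ∃ j, j ∉ S ∧ x j = 0 ∧ z = x + Pi.single j 1) (A + A) x := by
      intro z hz
      simp only [Finset.mem_image, Finset.mem_filter, Finset.mem_univ, true_and] at hz
      obtain ⟨j, hj, rfl⟩ := hz
      exact (Finset.mem_bipartiteAbove _).2
        ⟨Finset.add_mem_add hx (h.2 j), j, hj.1, hj.2, rfl⟩
    refine le_trans ?_ (Finset.card_le_card hsub)
    rw [Finset.card_image_of_injective]
    · have hsplit : Sᶜ = (Finset.univ.filter fun j => j ∉ S ∧ x j = 0) ∪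
          Finset.univ.filter fun j => j ∉ S ∧ x j ≠ 0 := by
        ext j; simp; tauto
      have hle := Finset.card_union_le (Finset.univ.filter fun j => j ∉ S ∧ x j = 0)
          (Finset.univ.filter fun j => j ∉ S ∧ x j ≠ 0)
      have := hw x hx
      unfold weightOutside at this
      rw [← hsplit] at hle
      omega
    · intro i j hij
      by_contra hne
      have := congrFun (add_left_cancel hij) i
      simp [hne] at this
  · rcases (Finset.bipartiteBelow (fun x z => ∃ j, j ∉ S ∧ x j = 0 ∧ z = x + Pi.single j 1)
      A z).eq_empty_or_nonempty with he | ⟨x, hx⟩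
    · rw [he]; simp
    · obtain ⟨hxA, j, hj, hxj, rfl⟩ := (Finset.mem_bipartiteBelow _).1 hx
      set N := Finset.univ.filter fun i => i ∉ S ∧ x i ≠ 0
      have hN : N.card ≤ 1 := hw x hxA
      have hsub : Finset.bipartiteBelow
          (fun x z => ∃ j, j ∉ S ∧ x j = 0 ∧ z = x + Pi.single j 1) A (x + Pi.single j 1) ⊆
          (insert j N).image fun i => x + Pi.single j 1 + Pi.single i 1 := by
        intro y hy
        obtain ⟨-, i, hi, hyi, hxy⟩ := (Finset.mem_bipartiteBelow _).1 hy
        refine Finset.mem_image.2 ⟨i, ?_, by rw [hxy, add_add_self_cancel]⟩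
        rw [Finset.mem_insert]
        rcases eq_or_ne i j with hij | hij
        · exact Or.inl hij
        · right
          have := congrFun hxy i
          simp only [Pi.add_apply, Pi.single_eq_of_ne hij, Pi.single_eq_same, hyi] at this
          simp only [N, Finset.mem_filter, Finset.mem_univ, true_and]
          refine ⟨hi, ?_⟩
          rw [add_zero, zero_add] at this
          rw [this]; decide
      refine (Finset.card_le_card hsub).trans (Finset.card_image_le.trans ?_)
      exact (Finset.card_insert_le _ _).trans (by omega)

theorem two_pow_card_le_card {S : Finset ι} {A : Finset (ι → ZMod 2)} (h : ContainsFrame S A) :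
    2 ^ S.card ≤ A.card := by
  have : (Fintype.piFinset fun i => if i ∈ S then Finset.univ else {(0 : ZMod 2)}) ⊆ A := by
    intro x hx
    refine h.1 x fun i hi => ?_
    simpa [hi] using Fintype.mem_piFinset.1 hx i
  refine le_trans (le_of_eq ?_) (Finset.card_le_card this)
  rw [Fintype.card_piFinset]
  simp [apply_ite Finset.card]

/-- A set containing zero and all standard basis vectors, with doubling at most `K`, has density
at least `2 ^ (-(2 * K + 1))`. -/
theorem two_pow_card_le_of_doubling (A : Finset (ι → ZMod 2)) (h0 : 0 ∈ A)
    (h1 : ∀ i, Pi.single i 1 ∈ A) {K : ℝ} (hK : ((A + A).card : ℝ) ≤ K * A.card) :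
    (2 : ℝ) ^ Fintype.card ι ≤ 2 ^ (2 * K + 1) * A.card := by
  obtain ⟨S, B, hB1, hB2, hB3, hw⟩ := exists_weightOutside_le_one ∅ A
    ⟨fun x hx => by rwa [show x = 0 from funext fun i => hx i (by simp)], h1⟩
  have hpos : (0 : ℝ) < A.card := by exact_mod_cast Finset.card_pos.2 ⟨0, h0⟩
  have hr : (Sᶜ.card : ℝ) ≤ 2 * K + 1 := by
    have hcount := (card_mul_le_two_mul_card_add hB3 hw).trans (Nat.mul_le_mul_right 2 hB2)
    rw [hB1] at hcount
    have hcount' : (A.card : ℝ) * (Sᶜ.card - 1 : ℕ) ≤ (A + A).card * 2 := by exact_mod_cast hcount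
    have hsub : (Sᶜ.card : ℝ) ≤ (Sᶜ.card - 1 : ℕ) + 1 := by
      exact_mod_cast (by omega : Sᶜ.card ≤ Sᶜ.card - 1 + 1)
    have : ((Sᶜ.card - 1 : ℕ) : ℝ) ≤ 2 * K := by
      refine le_of_mul_le_mul_left ?_ hpos
      linarith
    linarith
  have hS : (2 : ℝ) ^ S.card ≤ A.card := by exact_mod_cast hB1 ▸ two_pow_card_le_card hB3
  rw [← Finset.card_add_card_compl S, pow_add, mul_comm]
  refine mul_le_mul ?_ hS (by positivity) (by positivity)
  rw [← Real.rpow_natCast]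
  exact Real.rpow_le_rpow_of_exponent_le one_le_two hr

end Compression

theorem exists_submodule_card_le {n : ℕ} (A : Finset (F2 n)) (hA : A.Nonempty) {K : ℝ}
    (hK : ((A + A).card : ℝ) ≤ K * A.card) :
    ∃ (W : Submodule (ZMod 2) (F2 n)) (t : F2 n),
      (↑A : Set (F2 n)) ⊆ t +ᵥ (W : Set (F2 n)) ∧
      (Nat.card W : ℝ) ≤ (2 : ℝ) ^ (2 * K + 1) * A.card := by
  classical
  obtain ⟨t, ht⟩ := hA
  set A' : Finset (F2 n) := {t} + A with hA'
  have hA'card : A'.card = A.card := Finset.card_singleton_add t A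
  have hsum : A' + A' = A + A := by
    rw [hA', add_add_add_comm, Finset.singleton_add_singleton, ZModModule.add_self,
      Finset.singleton_zero, zero_add]
  obtain ⟨b, hbA, hspan, hli⟩ := exists_linearIndependent (ZMod 2) (A' : Set (F2 n))
  have : Fintype b := Fintype.ofFinite b
  set L := Fintype.linearCombination (ZMod 2) ((↑) : b → F2 n) with hL
  have hinj : Function.Injective L := hli.fintypeLinearCombination_injective
  have hrange : LinearMap.range L = Submodule.span (ZMod 2) (A' : Set (F2 n)) := by
    rw [hL, Fintype.range_linearCombination, Subtype.range_coe, hspan]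
  set D : Finset (b → ZMod 2) := Finset.univ.filter fun x => L x ∈ A'
  have himage : D.image L = A' := by
    ext y
    simp only [D, Finset.mem_image, Finset.mem_filter, Finset.mem_univ, true_and]
    constructor
    · rintro ⟨x, hx, rfl⟩; exact hx
    · intro hy
      have : y ∈ LinearMap.range L := hrange ▸ Submodule.subset_span hy
      obtain ⟨x, rfl⟩ := this
      exact ⟨x, hy, rfl⟩
  have hDcard : D.card = A.card := by
    rw [← hA'card, ← himage, Finset.card_image_of_injective _ hinj]
  have hDsum : (D + D).card = (A + A).card := by
    rw [← hsum, ← himage, ← Finset.image_add L, Finset.card_image_of_injective _ hinj]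
  have hbound := two_pow_card_le_of_doubling D
    (by
      rw [Finset.mem_filter, map_zero, ← ZModModule.add_self t]
      exact ⟨Finset.mem_univ _, Finset.add_mem_add (Finset.mem_singleton_self t) ht⟩)
    (fun i => by
      simpa [D, hL, Fintype.linearCombination_apply_single] using hbA i.2)
    (K := K) (by rwa [hDsum, hDcard])
  refine ⟨LinearMap.range L, t, fun x hx => ?_, ?_⟩
  · refine Set.mem_vadd_set.2 ⟨t + x, ?_, ?_⟩
    · rw [hrange]
      exact Submodule.subset_span (by simpa [hA'] using hx)
    · rw [vadd_eq_add, ← add_assoc, ZModModule.add_self, zero_add]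
  · rw [← Nat.card_congr (LinearEquiv.ofInjective L hinj).toEquiv, Nat.card_eq_fintype_card,
      Fintype.card_fun, ZMod.card, Nat.cast_pow, Nat.cast_ofNat, ← hDcard]
    exact hbound

/-- Asymptotic Freiman theorem in `F_2^n` (upper bound part of Theorem 1.4):
any nonempty `A ⊆ F_2^n` with `|A+A| ≤ K|A|` (`K ≥ 2`) is contained in an affine
subspace of size at most `2^(2K + C √K log₂ K) |A|`. -/
theorem freiman_F2_upper :
    ∃ C : ℝ, 0 ≤ C ∧
      ∀ K : ℝ, 2 ≤ K → ∀ n : ℕ, 1 ≤ n → ∀ A : Finset (F2 n), A.Nonempty →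
        ((A + A).card : ℝ) ≤ K * A.card →
        ∃ (W : Submodule (ZMod 2) (F2 n)) (t : F2 n),
          (↑A : Set (F2 n)) ⊆ t +ᵥ (W : Set (F2 n)) ∧
          (Nat.card W : ℝ) ≤
            (2 : ℝ) ^ (2 * K + C * Real.sqrt K * Real.logb 2 K) * A.card := by
  refine ⟨1, zero_le_one, fun K hK n _ A hA hAK => ?_⟩
  obtain ⟨W, t, hW, hcard⟩ := exists_submodule_card_le A hA hAK
  refine ⟨W, t, hW, hcard.trans ?_⟩
  gcongr
  · exact one_le_two
  · have hsqrt : 1 ≤ Real.sqrt K := Real.one_le_sqrt.2 (by linarith)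
    have hlog : 1 ≤ Real.logb 2 K := by
      rw [Real.le_logb_iff_rpow_le one_lt_two (by linarith), Real.rpow_one]
      exact hK
    rw [one_mul]
    exact one_le_mul_of_one_le_of_one_le hsqrt hlog
end

section
/- There is an absolute constant C ≥ 0 with the following property: if A ⊆ F_2^n is a nonempty shift-minimal downset, K ≥ 1 is a real number with |A + A| ≤ K·|A|, and m := ⌊log₂ |A|⌋, then there exists a finite set T ⊆ F_2^n with |T| ≤ C·K^30 such that A ⊆ ⋃_{t ∈ T} (t + F_2^m), where F_2^m is the coordinate subspace {x ∈ F_2^n : x_i = 0 for all i > m}. -/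
open Finset Pointwise

/-- The bilinear lower bound for the entropy of a sum of two independent bits
of entropies `u` and `v`. -/
noncomputable def entropyForm (u v : ℝ) : ℝ :=
  (u + v) / 2 + (u * (Real.log 2 - v) + v * (Real.log 2 - u)) / (29 * Real.log 2)

theorem negMulLog_add_mul_log_le {r y : ℝ} (hr : 0 ≤ r) (hy : 0 ≤ y) (h : y = 0 → r = 0) :
    Real.negMulLog r + r * Real.log y ≤ y - r := by
  rcases hr.eq_or_lt with rfl | hr
  · simpa using hy
  have hy' : 0 < y := hy.lt_of_ne fun h0 => hr.ne' (h h0.symm)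
  have h1 := Real.log_le_sub_one_of_pos (div_pos hy' hr)
  rw [Real.log_div hy'.ne' hr.ne'] at h1
  have h2 := mul_le_mul_of_nonneg_left h1 hr.le
  have h3 : r * (y / r - 1) = y - r := by field_simp
  rw [h3] at h2
  simp only [Real.negMulLog]
  linarith

/-- Gibbs' inequality for two outcomes. -/
theorem binEntropy_add_le_log_add {r x y : ℝ} (hr : 0 ≤ r) (hr' : r ≤ 1) (hx : 0 < x)
    (hy : 0 ≤ y) (h : y = 0 → r = 0) :
    Real.binEntropy r + (1 - r) * Real.log x + r * Real.log y ≤ Real.log (x + y) := by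
  have hs : 0 < x + y := by linarith
  have h1 := negMulLog_add_mul_log_le (r := 1 - r) (y := x / (x + y)) (by linarith)
    (by positivity) (fun h0 => absurd h0 (by positivity))
  have h2 := negMulLog_add_mul_log_le (r := r) (y := y / (x + y)) hr
    (by positivity) (fun h0 => h (by simpa [hs.ne'] using h0))
  rw [Real.log_div hx.ne' hs.ne'] at h1
  have h3 : r * Real.log (y / (x + y)) = r * (Real.log y - Real.log (x + y)) := by
    rcases hy.eq_or_lt with h0 | h0
    · simp [h h0.symm]
    · rw [Real.log_div h0.ne' hs.ne']
  have h4 : x / (x + y) + y / (x + y) = 1 := by field_simp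
  rw [Real.binEntropy_eq_negMulLog_add_negMulLog_one_sub]
  rw [h3] at h2
  linarith

/-- The binary entropy lies below its tangents. -/
theorem binEntropy_le_tangent {r t : ℝ} (hr : 0 ≤ r) (hr' : r ≤ 1) (ht : 0 < t) (ht' : t < 1) :
    Real.binEntropy r + (t - r) * (Real.log (1 - t) - Real.log t) ≤ Real.binEntropy t := by
  have h := binEntropy_add_le_log_add hr hr' (sub_pos.2 ht') ht.le (fun h0 => absurd h0 ht.ne')
  rw [sub_add_cancel, Real.log_one] at h
  rw [Real.binEntropy_eq_negMulLog_add_negMulLog_one_sub t]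
  simp only [Real.negMulLog]
  linarith

theorem binEntropy_le_mul_one_sub_log {r : ℝ} (hr : r < 1) :
    Real.binEntropy r ≤ r * (1 - Real.log r) := by
  have h := negMulLog_add_mul_log_le (r := 1 - r) (y := 1) (by linarith) zero_le_one (by simp)
  rw [Real.log_one] at h
  rw [Real.binEntropy_eq_negMulLog_add_negMulLog_one_sub]
  simp only [Real.negMulLog] at h ⊢
  linarith

theorem binEntropy_concave {x y a b : ℝ} (hx : 0 ≤ x) (hx' : x ≤ 1) (hy : 0 ≤ y) (hy' : y ≤ 1)
    (ha : 0 ≤ a) (hb : 0 ≤ b) (hab : a + b = 1) :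
    a * Real.binEntropy x + b * Real.binEntropy y ≤ Real.binEntropy (a * x + b * y) := by
  simpa using Real.strictConcave_binEntropy.concaveOn.2 (x := x) (y := y)
    ⟨hx, hx'⟩ ⟨hy, hy'⟩ ha hb hab

theorem binEntropy_mono {x y : ℝ} (hx : 0 ≤ x) (hxy : x ≤ y) (hy : y ≤ 1 / 2) :
    Real.binEntropy x ≤ Real.binEntropy y := by
  refine Real.binEntropy_strictMonoOn.monotoneOn ⟨hx, ?_⟩ ⟨hx.trans hxy, ?_⟩ hxy <;> linarith

theorem mul_binEntropy_le_of_le_eighth {r : ℝ} (hr : 0 ≤ r) (hr' : r ≤ 1 / 8) :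
    (1 + 2 / 29) * Real.binEntropy r ≤ Real.binEntropy (2 * r * (1 - r)) := by
  rcases hr.eq_or_lt with rfl | hr
  · simp
  set t := 2 * r * (1 - r) with ht
  have ht0 : 0 < t := by rw [ht]; nlinarith
  have ht1 : t ≤ 2 * r := by rw [ht]; nlinarith
  have h1 := binEntropy_le_tangent hr.le (by linarith) ht0 (by linarith)
  have h2 := binEntropy_le_mul_one_sub_log (r := r) (by linarith)
  have h3 : Real.log t ≤ Real.log 2 + Real.log r := by
    rw [← Real.log_mul two_ne_zero hr.ne']
    exact Real.log_le_log ht0 ht1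
  have h4 : -(1 / 3) ≤ Real.log (1 - t) := by
    have := Real.one_sub_inv_le_log_of_pos (x := 1 - t) (by linarith)
    have h5 : (1 - t)⁻¹ ≤ 4 / 3 := by
      rw [inv_le_comm₀ (by linarith) (by norm_num)]
      linarith
    linarith
  have h5 : Real.log r ≤ -(3 * Real.log 2) := by
    have := Real.log_le_log hr hr'
    rw [show (1 / 8 : ℝ) = (2 ^ 3)⁻¹ by norm_num, Real.log_inv, Real.log_pow] at this
    simpa using this
  have hl := Real.log_two_gt_d9
  have h6 : 3 / 4 * r ≤ t - r := by rw [ht]; nlinarith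
  have h7 : 0 ≤ Real.log (1 - t) - Real.log t := by linarith
  have h8 : 3 / 4 * r * (Real.log (1 - t) - Real.log t)
      ≤ (t - r) * (Real.log (1 - t) - Real.log t) := mul_le_mul_of_nonneg_right h6 h7
  have h9 : 2 / 29 * (1 - Real.log r) ≤ 3 / 4 * (Real.log (1 - t) - Real.log t) := by linarith
  have h10 := mul_le_mul_of_nonneg_left h9 hr.le
  linarith

theorem entropyForm_comm (u v : ℝ) : entropyForm u v = entropyForm v u := by
  simp only [entropyForm]
  ring

theorem entropyForm_le_add {u v : ℝ} (hu : 0 ≤ u) (hv : 0 ≤ v) :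
    entropyForm u v ≤ (1 / 2 + 1 / 29) * (u + v) := by
  have hl : 0 < Real.log 2 := Real.log_pos one_lt_two
  have h : (u * (Real.log 2 - v) + v * (Real.log 2 - u)) / (29 * Real.log 2)
      ≤ 1 / 29 * (u + v) := by
    rw [div_le_iff₀ (by positivity)]
    nlinarith [mul_nonneg hu hv]
  rw [entropyForm]
  linarith

/-- Entropy growth for the sum of two independent bits, each at most as likely to be `1` as `0`. -/
theorem entropyForm_le_binEntropy {p q : ℝ} (hp : 0 ≤ p) (hp' : p ≤ 1 / 2) (hq : 0 ≤ q)
    (hq' : q ≤ 1 / 2) :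
    entropyForm (Real.binEntropy p) (Real.binEntropy q)
      ≤ Real.binEntropy (p * (1 - q) + q * (1 - p)) := by
  wlog hqp : q ≤ p generalizing p q
  · rw [entropyForm_comm, add_comm (p * _)]
    exact this hq hq' hp hp' (le_of_not_ge hqp)
  set u := Real.binEntropy p with hu
  set v := Real.binEntropy q with hv
  set t := p * (1 - q) + q * (1 - p) with ht
  have hl := Real.log_two_gt_d9
  have hl' := Real.log_two_lt_d9
  have hL : 0 < Real.log 2 := by linarith
  have hu0 : 0 ≤ u := Real.binEntropy_nonneg hp (by linarith)
  have hv0 : 0 ≤ v := Real.binEntropy_nonneg hq (by linarith)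
  have huL : u ≤ Real.log 2 := Real.binEntropy_le_log_two
  have hvL : v ≤ Real.log 2 := Real.binEntropy_le_log_two
  have ht' : t ≤ 1 / 2 := by rw [ht]; nlinarith
  have hhalf : Real.binEntropy (1 / 2) = Real.log 2 := by
    rw [one_div, Real.binEntropy_two_inv]
  rcases le_total (p + q) (1 / 4) with hs | hs
  · have h1 := mul_binEntropy_le_of_le_eighth (r := (p + q) / 2) (by linarith) (by linarith)
    have h2 : Real.binEntropy (2 * ((p + q) / 2) * (1 - (p + q) / 2)) ≤ Real.binEntropy t :=
      binEntropy_mono (by nlinarith) (by rw [ht]; nlinarith [sq_nonneg (p - q)]) ht'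
    have h3 := binEntropy_concave (x := p) (y := q) (a := 1 / 2) (b := 1 / 2) hp (by linarith) hq
      (by linarith) (by norm_num) (by norm_num) (by norm_num)
    rw [show 1 / 2 * p + 1 / 2 * q = (p + q) / 2 by ring] at h3
    have h4 := entropyForm_le_add hu0 hv0
    linarith
  rcases le_total (1 / 29) q with hq1 | hq1
  · have h1 := binEntropy_concave (x := p) (y := 1 / 2) (a := 1 - 2 * q) (b := 2 * q) hp
      (by linarith) (by norm_num) (by norm_num) (by linarith) (by linarith) (by ring)
    have h2 := binEntropy_concave (x := q) (y := 1 / 2) (a := 1 - 2 * p) (b := 2 * p) hq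
      (by linarith) (by norm_num) (by norm_num) (by linarith) (by linarith) (by ring)
    rw [show (1 - 2 * q) * p + 2 * q * (1 / 2) = t by rw [ht]; ring, hhalf] at h1
    rw [show (1 - 2 * p) * q + 2 * p * (1 / 2) = t by rw [ht]; ring, hhalf] at h2
    have h3 : (u * (Real.log 2 - v) + v * (Real.log 2 - u)) / (29 * Real.log 2)
        ≤ p * (Real.log 2 - v) + q * (Real.log 2 - u) := by
      rw [div_le_iff₀ (by positivity)]
      have h4 : u ≤ p * (29 * Real.log 2) := by nlinarith
      have h5 : v ≤ q * (29 * Real.log 2) := by nlinarith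
      have h6 := mul_le_mul_of_nonneg_right h4 (sub_nonneg.2 hvL)
      have h7 := mul_le_mul_of_nonneg_right h5 (sub_nonneg.2 huL)
      linarith
    rw [entropyForm]
    linarith
  · have h1 : u ≤ Real.binEntropy t := binEntropy_mono hp (by rw [ht]; nlinarith) ht'
    have h2 := binEntropy_concave (x := 0) (y := 1 / 2) (a := 1 - 2 * p) (b := 2 * p) le_rfl
      (by norm_num) (by norm_num) (by norm_num) (by linarith) (by linarith) (by ring)
    rw [hhalf, Real.binEntropy_zero,
      show (1 - 2 * p) * 0 + 2 * p * (1 / 2) = p by ring] at h2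
    have h3 : v ≤ 1 / 29 * (1 + 5 * Real.log 2) := by
      refine (binEntropy_mono hq hq1 (by norm_num)).trans
        ((binEntropy_le_mul_one_sub_log (by norm_num)).trans ?_)
      have h4 : Real.log 29 ≤ 5 * Real.log 2 := by
        rw [show 5 * Real.log 2 = Real.log (2 ^ 5) by rw [Real.log_pow]; norm_num]
        exact Real.log_le_log (by norm_num) (by norm_num)
      rw [one_div, Real.log_inv]
      linarith
    have h4 := entropyForm_le_add hu0 hv0
    have h5 : 2 * (1 / 4 - 1 / 29) * Real.log 2 ≤ u := by nlinarith
    linarith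

theorem log_natCast_mono {a b : ℕ} (h : a ≤ b) : Real.log (a : ℝ) ≤ Real.log b := by
  rcases Nat.eq_zero_or_pos a with rfl | ha
  · simpa using Real.log_natCast_nonneg b
  · exact Real.log_le_log (by exact_mod_cast ha) (by exact_mod_cast h)

/-- The points of `A` with first coordinate `b`, with that coordinate removed. -/
def bitSlice {n : ℕ} (A : Finset (F2 (n + 1))) (b : ZMod 2) : Finset (F2 n) :=
  Finset.univ.filter fun x => (Fin.cons b x : F2 (n + 1)) ∈ A

theorem mem_bitSlice {n : ℕ} {A : Finset (F2 (n + 1))} {b : ZMod 2} {x : F2 n} :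
    x ∈ bitSlice A b ↔ (Fin.cons b x : F2 (n + 1)) ∈ A := by
  simp [bitSlice]

theorem zmod_two_cases (b : ZMod 2) : b = 0 ∨ b = 1 := by
  revert b
  decide

theorem card_bitSlice {n : ℕ} (A : Finset (F2 (n + 1))) :
    (bitSlice A 0).card + (bitSlice A 1).card = A.card := by
  classical
  have hcard (b : ZMod 2) : (bitSlice A b).card = (A.filter fun x => x 0 = b).card := by
    refine Finset.card_bij (fun x _ => (Fin.cons b x : F2 (n + 1))) ?_ ?_ ?_
    · intro x hx
      simpa using mem_bitSlice.1 hx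
    · intro x _ y _ h
      exact (Fin.cons_inj.1 h).2
    · intro y hy
      obtain ⟨hy, rfl⟩ := Finset.mem_filter.1 hy
      exact ⟨Fin.tail y, mem_bitSlice.2 (by rwa [Fin.cons_self_tail]), Fin.cons_self_tail y⟩
  rw [hcard, hcard, ← Finset.card_filter_add_card_filter_not (s := A) (fun x => x 0 = 0)]
  congr 2
  refine Finset.filter_congr fun x _ => ?_
  rcases zmod_two_cases (x 0) with h | h <;> simp [h]

theorem cons_add_stdBasis_succ {n : ℕ} (b : ZMod 2) (x : F2 n) (i : Fin n) :
    (Fin.cons b x : F2 (n + 1)) + stdBasis i.succ = Fin.cons b (x + stdBasis i) := by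
  funext j
  refine Fin.cases ?_ (fun j => ?_) j
  · simp [stdBasis]
  · simp [stdBasis, Pi.single_apply]

theorem cons_add_stdBasis_zero {n : ℕ} (b : ZMod 2) (x : F2 n) :
    (Fin.cons b x : F2 (n + 1)) + stdBasis 0 = Fin.cons (b + 1) x := by
  funext j
  refine Fin.cases ?_ (fun j => ?_) j
  · simp [stdBasis]
  · simp [stdBasis]

theorem IsDownset.slice {n : ℕ} {A : Finset (F2 (n + 1))} (hA : IsDownset A) (b : ZMod 2) :
    IsDownset (bitSlice A b) := by
  intro x i hx h
  rw [mem_bitSlice, ← cons_add_stdBasis_succ] at h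
  exact mem_bitSlice.2 (hA _ i.succ (by simpa using hx) h)

theorem IsShiftMinimal.slice {n : ℕ} {A : Finset (F2 (n + 1))} (hA : IsShiftMinimal A)
    (b : ZMod 2) : IsShiftMinimal (bitSlice A b) := by
  intro x i j hij hi hj h
  rw [mem_bitSlice, ← cons_add_stdBasis_succ] at h ⊢
  exact hA _ i.succ j.succ (Fin.succ_lt_succ_iff.2 hij) (by simpa using hi) (by simpa using hj) h

theorem IsDownset.slice_one_subset {n : ℕ} {A : Finset (F2 (n + 1))} (hA : IsDownset A) :
    bitSlice A 1 ⊆ bitSlice A 0 := by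
  intro x hx
  rw [mem_bitSlice] at hx ⊢
  exact hA _ 0 rfl (by rwa [cons_add_stdBasis_zero, zero_add])

theorem IsShiftMinimal.slice_slice_subset {n : ℕ} {A : Finset (F2 (n + 2))}
    (hA : IsShiftMinimal A) :
    bitSlice (bitSlice A 0) 1 ⊆ bitSlice (bitSlice A 1) 0 := by
  intro x hx
  rw [mem_bitSlice, mem_bitSlice] at hx ⊢
  have h := hA (Fin.cons 0 (Fin.cons 0 x)) 0 (Fin.succ 0) (Fin.succ_pos 0) rfl rfl
    (by rwa [cons_add_stdBasis_succ, cons_add_stdBasis_zero, zero_add])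
  rwa [cons_add_stdBasis_zero, zero_add] at h

/-- A downset is closed under setting coordinates to zero. -/
theorem IsDownset.zero_on_mem {n : ℕ} {A : Finset (F2 n)} (hA : IsDownset A) {x : F2 n}
    (hx : x ∈ A) (S : Finset (Fin n)) : (fun i => if i ∈ S then 0 else x i) ∈ A := by
  induction S using Finset.induction_on with
  | empty => simpa using hx
  | insert a S ha ih =>
    rcases zmod_two_cases (x a) with h | h
    · convert ih using 2 with i
      by_cases hi : i = a
      · simp [hi, h]
      · simp [hi]
    · refine hA _ a (by simp) ?_
      convert ih using 1
      funext i
      by_cases hi : i = a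
      · subst hi
        simp [stdBasis, ha, h]
      · simp [stdBasis, hi]

theorem IsDownset.zero_mem {n : ℕ} {A : Finset (F2 n)} (hA : IsDownset A) (h : A.Nonempty) :
    (0 : F2 n) ∈ A := by
  obtain ⟨x, hx⟩ := h
  simpa [Pi.zero_def] using hA.zero_on_mem hx Finset.univ

theorem IsDownset.slice_zero_nonempty {n : ℕ} {A : Finset (F2 (n + 1))} (hA : IsDownset A)
    (h : A.Nonempty) : (bitSlice A 0).Nonempty := by
  refine ⟨0, mem_bitSlice.2 ?_⟩
  convert hA.zero_mem h using 1
  funext i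
  refine Fin.cases ?_ (fun i => ?_) i <;> simp

/-- The proportion of points of `A` with first coordinate `1`. -/
noncomputable def oneFrac {n : ℕ} (A : Finset (F2 (n + 1))) : ℝ :=
  (bitSlice A 1).card / A.card

theorem oneFrac_nonneg {n : ℕ} (A : Finset (F2 (n + 1))) : 0 ≤ oneFrac A := by
  rw [oneFrac]
  positivity

theorem oneFrac_le_one {n : ℕ} (A : Finset (F2 (n + 1))) : oneFrac A ≤ 1 := by
  refine div_le_one_of_le₀ ?_ (by positivity)
  exact_mod_cast (card_bitSlice A ▸ Nat.le_add_left _ _)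

theorem IsDownset.oneFrac_le_half {n : ℕ} {A : Finset (F2 (n + 1))} (hA : IsDownset A) :
    oneFrac A ≤ 1 / 2 := by
  rcases A.eq_empty_or_nonempty with rfl | h
  · simp [oneFrac]
  have hc : (0 : ℝ) < A.card := by exact_mod_cast h.card_pos
  rw [oneFrac, div_le_iff₀ hc, ← card_bitSlice A]
  have h1 : ((bitSlice A 1).card : ℝ) ≤ (bitSlice A 0).card := by
    exact_mod_cast Finset.card_le_card hA.slice_one_subset
  push_cast
  linarith

theorem oneFrac_mul_card {n : ℕ} (A : Finset (F2 (n + 1))) :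
    oneFrac A * A.card = (bitSlice A 1).card := by
  rcases A.eq_empty_or_nonempty with rfl | h
  · simp [bitSlice]
  · have hc : (A.card : ℝ) ≠ 0 := by exact_mod_cast h.card_pos.ne'
    rw [oneFrac, div_mul_cancel₀ _ hc]

theorem one_sub_oneFrac_mul_card {n : ℕ} (A : Finset (F2 (n + 1))) :
    (1 - oneFrac A) * A.card = (bitSlice A 0).card := by
  have h : ((bitSlice A 0).card : ℝ) + (bitSlice A 1).card = A.card := by
    exact_mod_cast card_bitSlice A
  rw [sub_mul, oneFrac_mul_card]
  linarith

theorem oneFrac_eq_zero {n : ℕ} {A : Finset (F2 (n + 1))} (h : bitSlice A 1 = ∅) :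
    oneFrac A = 0 := by
  simp [oneFrac, h]

/-- For a uniformly random point of `A`, the entropy of coordinate `i` given the coordinates
before it. -/
noncomputable def coordEntropy : (n : ℕ) → Finset (F2 n) → ℕ → ℝ
  | 0, _, _ => 0
  | _ + 1, A, 0 => Real.binEntropy (oneFrac A)
  | n + 1, A, i + 1 => (1 - oneFrac A) * coordEntropy n (bitSlice A 0) i
      + oneFrac A * coordEntropy n (bitSlice A 1) i

theorem coordEntropy_nonneg {n : ℕ} (A : Finset (F2 n)) (i : ℕ) : 0 ≤ coordEntropy n A i := by
  induction n generalizing i with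
  | zero => simp [coordEntropy]
  | succ n ih =>
    cases i with
    | zero => exact Real.binEntropy_nonneg (oneFrac_nonneg A) (oneFrac_le_one A)
    | succ i =>
      exact add_nonneg (mul_nonneg (sub_nonneg.2 (oneFrac_le_one A)) (ih _ i))
        (mul_nonneg (oneFrac_nonneg A) (ih _ i))

theorem coordEntropy_le_log_two {n : ℕ} (A : Finset (F2 n)) (i : ℕ) :
    coordEntropy n A i ≤ Real.log 2 := by
  induction n generalizing i with
  | zero => simpa [coordEntropy] using Real.log_nonneg one_le_two
  | succ n ih =>
    cases i with
    | zero => exact Real.binEntropy_le_log_two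
    | succ i =>
      have h0 := mul_le_mul_of_nonneg_left (ih (bitSlice A 0) i) (sub_nonneg.2 (oneFrac_le_one A))
      have h1 := mul_le_mul_of_nonneg_left (ih (bitSlice A 1) i) (oneFrac_nonneg A)
      rw [coordEntropy]
      linarith

theorem coordEntropy_succ_le {n : ℕ} {A : Finset (F2 n)} (hA : IsDownset A)
    (hA' : IsShiftMinimal A) (i : ℕ) : coordEntropy n A (i + 1) ≤ coordEntropy n A i := by
  induction n generalizing i with
  | zero => simp [coordEntropy]
  | succ n ih =>
    cases i with
    | succ i =>
      exact add_le_add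
        (mul_le_mul_of_nonneg_left (ih (hA.slice 0) (hA'.slice 0) i)
          (sub_nonneg.2 (oneFrac_le_one A)))
        (mul_le_mul_of_nonneg_left (ih (hA.slice 1) (hA'.slice 1) i) (oneFrac_nonneg A))
    | zero =>
      cases n with
      | zero => simpa [coordEntropy] using coordEntropy_nonneg A 0
      | succ n =>
        simp only [coordEntropy]
        refine (binEntropy_concave (oneFrac_nonneg _) (oneFrac_le_one _) (oneFrac_nonneg _)
          (oneFrac_le_one _) (sub_nonneg.2 (oneFrac_le_one A)) (oneFrac_nonneg A)
          (sub_add_cancel 1 _)).trans ?_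
        have h0 := oneFrac_nonneg A
        have h1 := sub_nonneg.2 (oneFrac_le_one A)
        refine binEntropy_mono (add_nonneg (mul_nonneg h1 (oneFrac_nonneg _))
          (mul_nonneg h0 (oneFrac_nonneg _))) ?_ hA.oneFrac_le_half
        rcases A.eq_empty_or_nonempty with rfl | h
        · simp [oneFrac, bitSlice]
        have hc : (0 : ℝ) < A.card := by exact_mod_cast h.card_pos
        refine le_of_mul_le_mul_right ?_ hc
        have h2 : ((bitSlice (bitSlice A 0) 1).card : ℝ) ≤ (bitSlice (bitSlice A 1) 0).card := by
          exact_mod_cast Finset.card_le_card hA'.slice_slice_subset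
        rw [oneFrac_mul_card, add_mul, mul_right_comm, one_sub_oneFrac_mul_card, mul_right_comm,
          oneFrac_mul_card, mul_comm, oneFrac_mul_card, mul_comm, oneFrac_mul_card]
        have h3 : ((bitSlice (bitSlice A 1) 0).card : ℝ) + (bitSlice (bitSlice A 1) 1).card
          = (bitSlice A 1).card := by exact_mod_cast card_bitSlice (bitSlice A 1)
        linarith

theorem coordEntropy_antitone {n : ℕ} {A : Finset (F2 n)} (hA : IsDownset A)
    (hA' : IsShiftMinimal A) : Antitone (coordEntropy n A) :=
  antitone_nat_of_succ_le (coordEntropy_succ_le hA hA')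

theorem binEntropy_add_log_mul {p N : ℝ} (hN : N ≠ 0) :
    Real.binEntropy p + (1 - p) * Real.log ((1 - p) * N) + p * Real.log (p * N)
      = Real.log N := by
  have h (r : ℝ) : r * Real.log (r * N) = r * Real.log r + r * Real.log N := by
    rcases eq_or_ne r 0 with rfl | hr
    · simp
    · rw [Real.log_mul hr hN]
      ring
  rw [h, h, Real.binEntropy_eq_negMulLog_add_negMulLog_one_sub]
  simp only [Real.negMulLog]
  ring

/-- The chain rule for entropy. -/
theorem sum_coordEntropy {n : ℕ} (A : Finset (F2 n)) :
    ∑ i ∈ Finset.range n, coordEntropy n A i = Real.log A.card := by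
  induction n with
  | zero =>
    have h : A.card ≤ 1 := Finset.card_le_one_of_subsingleton A
    interval_cases A.card <;> simp
  | succ n ih =>
    rcases A.eq_empty_or_nonempty with rfl | h
    · have h0 (b : ZMod 2) : bitSlice (∅ : Finset (F2 (n + 1))) b = ∅ := by simp [bitSlice]
      rw [Finset.sum_range_succ']
      simp only [coordEntropy, Finset.sum_add_distrib, ← Finset.mul_sum, ih, h0,
        oneFrac_eq_zero (h0 1)]
      simp
    · have hc : (A.card : ℝ) ≠ 0 := by exact_mod_cast h.card_pos.ne'
      rw [Finset.sum_range_succ']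
      simp only [coordEntropy, Finset.sum_add_distrib, ← Finset.mul_sum, ih]
      rw [← binEntropy_add_log_mul (p := oneFrac A) hc, one_sub_oneFrac_mul_card,
        oneFrac_mul_card]
      ring

/-- The part of `A` lying in the coordinate subspace `F_2^s`. -/
def headPart {n : ℕ} (s : ℕ) (A : Finset (F2 n)) : Finset (F2 n) :=
  A.filter fun x => ∀ i : Fin n, s ≤ (i : ℕ) → x i = 0

theorem bitSlice_headPart {n : ℕ} (s : ℕ) (A : Finset (F2 (n + 1))) (b : ZMod 2) :
    bitSlice (headPart (s + 1) A) b = headPart s (bitSlice A b) := by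
  ext x
  simp [mem_bitSlice, headPart, Fin.forall_fin_succ]

theorem IsDownset.zero_mem_headPart {n : ℕ} {A : Finset (F2 n)} (hA : IsDownset A)
    (h : A.Nonempty) (s : ℕ) : (0 : F2 n) ∈ headPart s A := by
  simp [headPart, hA.zero_mem h]

theorem IsDownset.sum_coordEntropy_le {n : ℕ} {A : Finset (F2 n)} (hA : IsDownset A)
    {s : ℕ} (hs : s ≤ n) :
    ∑ i ∈ Finset.range s, coordEntropy n A i ≤ Real.log (headPart s A).card := by
  induction n generalizing s with
  | zero =>
    obtain rfl : s = 0 := by omega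
    simpa using Real.log_natCast_nonneg _
  | succ n ih =>
    cases s with
    | zero => simpa using Real.log_natCast_nonneg _
    | succ s =>
      rcases A.eq_empty_or_nonempty with rfl | h
      · have h1 := sum_coordEntropy (∅ : Finset (F2 (n + 1)))
        simp only [Finset.card_empty, Nat.cast_zero, Real.log_zero] at h1
        refine ((Finset.sum_le_sum_of_subset_of_nonneg (Finset.range_subset_range.2 hs)
          fun i _ _ => coordEntropy_nonneg _ i).trans h1.le).trans (Real.log_natCast_nonneg _)
      rw [Finset.sum_range_succ']
      simp only [coordEntropy, Finset.sum_add_distrib, ← Finset.mul_sum]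
      have h0 := mul_le_mul_of_nonneg_left (ih (hA.slice 0) (s := s) (by omega))
        (sub_nonneg.2 (oneFrac_le_one A))
      have h1 := mul_le_mul_of_nonneg_left (ih (hA.slice 1) (s := s) (by omega))
        (oneFrac_nonneg A)
      have hpos : (0 : ℝ) < (headPart s (bitSlice A 0)).card := by
        exact_mod_cast Finset.card_pos.2
          ⟨0, (hA.slice 0).zero_mem_headPart (hA.slice_zero_nonempty h) s⟩
      have h2 := binEntropy_add_le_log_add (oneFrac_nonneg A) (oneFrac_le_one A) hpos
        (y := (headPart s (bitSlice A 1)).card) (by positivity) (fun hy => by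
          refine oneFrac_eq_zero (Finset.not_nonempty_iff_eq_empty.1 fun hne => ?_)
          have := Finset.card_pos.2 ⟨0, (hA.slice 1).zero_mem_headPart hne s⟩
          have hy' : (headPart s (bitSlice A 1)).card = 0 := by exact_mod_cast hy
          omega)
      rw [← card_bitSlice (headPart (s + 1) A), bitSlice_headPart, bitSlice_headPart]
      push_cast
      linarith

theorem bitSlice_add_bitSlice_subset {n : ℕ} (A B : Finset (F2 (n + 1))) (a b : ZMod 2) :
    bitSlice A a + bitSlice B b ⊆ bitSlice (A + B) (a + b) := by
  intro z hz
  obtain ⟨x, hx, y, hy, rfl⟩ := Finset.mem_add.1 hz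
  rw [mem_bitSlice] at hx hy ⊢
  refine Finset.mem_add.2 ⟨_, hx, _, hy, ?_⟩
  funext i
  refine Fin.cases ?_ (fun i => ?_) i <;> simp

theorem entropyForm_affine (p q u₀ u₁ v₀ v₁ : ℝ) :
    entropyForm ((1 - p) * u₀ + p * u₁) ((1 - q) * v₀ + q * v₁)
      = (1 - p) * (1 - q) * entropyForm u₀ v₀ + (1 - p) * q * entropyForm u₀ v₁
        + p * (1 - q) * entropyForm u₁ v₀ + p * q * entropyForm u₁ v₁ := by
  simp only [entropyForm]
  ring

/-- The entropy lower bound for the sumset of two downsets. -/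
theorem sum_entropyForm_le_log_card_add {n : ℕ} {A B : Finset (F2 n)} (hA : IsDownset A)
    (hB : IsDownset B) (hA₀ : A.Nonempty) (hB₀ : B.Nonempty) :
    ∑ i ∈ Finset.range n, entropyForm (coordEntropy n A i) (coordEntropy n B i)
      ≤ Real.log (A + B).card := by
  induction n with
  | zero => simpa using Real.log_natCast_nonneg _
  | succ n ih =>
    have hp := oneFrac_nonneg A
    have hp' := hA.oneFrac_le_half
    have hq := oneFrac_nonneg B
    have hq' := hB.oneFrac_le_half
    have hA1 (h : ¬ (bitSlice A 1).Nonempty) : oneFrac A = 0 :=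
      oneFrac_eq_zero (Finset.not_nonempty_iff_eq_empty.1 h)
    have hB1 (h : ¬ (bitSlice B 1).Nonempty) : oneFrac B = 0 :=
      oneFrac_eq_zero (Finset.not_nonempty_iff_eq_empty.1 h)
    have hA0 := hA.slice_zero_nonempty hA₀
    have hB0 := hB.slice_zero_nonempty hB₀
    rw [Finset.sum_range_succ']
    simp only [coordEntropy, entropyForm_affine, Finset.sum_add_distrib, ← Finset.mul_sum]
    set p := oneFrac A
    set q := oneFrac B
    have hform := entropyForm_le_binEntropy hp hp' hq hq'
    have hterm (w : ℝ) (hw : 0 ≤ w) (a b c : ZMod 2) (hc : a + b = c)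
        (ha : ¬ (bitSlice A a).Nonempty → w = 0) (hb : ¬ (bitSlice B b).Nonempty → w = 0) :
        w * ∑ i ∈ Finset.range n,
            entropyForm (coordEntropy n (bitSlice A a) i) (coordEntropy n (bitSlice B b) i)
          ≤ w * Real.log (bitSlice (A + B) c).card := by
      by_cases hae : (bitSlice A a).Nonempty
      · by_cases hbe : (bitSlice B b).Nonempty
        · refine mul_le_mul_of_nonneg_left ((ih (hA.slice a) (hB.slice b) hae hbe).trans
            (log_natCast_mono (Finset.card_le_card ?_))) hw
          rw [← hc]
          exact bitSlice_add_bitSlice_subset A B a b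
        · simp [hb hbe]
      · simp [ha hae]
    have h00 := hterm ((1 - p) * (1 - q)) (mul_nonneg (by linarith) (by linarith)) 0 0 0 rfl
      (fun h => absurd hA0 h) (fun h => absurd hB0 h)
    have h01 := hterm ((1 - p) * q) (mul_nonneg (by linarith) (by linarith)) 0 1 1 rfl
      (fun h => absurd hA0 h) (fun h => by rw [hB1 h, mul_zero])
    have h10 := hterm (p * (1 - q)) (mul_nonneg (by linarith) (by linarith)) 1 0 1 rfl
      (fun h => by rw [hA1 h, zero_mul]) (fun h => absurd hB0 h)
    have h11 := hterm (p * q) (mul_nonneg (by linarith) (by linarith)) 1 1 0 rfl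
      (fun h => by rw [hA1 h, zero_mul]) (fun h => by rw [hB1 h, mul_zero])
    have hX : (0 : ℝ) < (bitSlice (A + B) 0).card := by
      exact_mod_cast Finset.card_pos.2 ((hA0.add hB0).mono (bitSlice_add_bitSlice_subset A B 0 0))
    have hg := binEntropy_add_le_log_add (r := p * (1 - q) + q * (1 - p))
      (add_nonneg (mul_nonneg hp (by linarith)) (mul_nonneg hq (by linarith)))
      (by nlinarith) hX (y := (bitSlice (A + B) 1).card) (by positivity) (fun hy => by
        have hy' : bitSlice (A + B) 1 = ∅ := Finset.card_eq_zero.1 (by exact_mod_cast hy)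
        have hpz : p = 0 := hA1 fun h => by
          have := (h.add hB0).mono (bitSlice_add_bitSlice_subset A B 1 0)
          rw [add_zero, hy'] at this
          exact Finset.not_nonempty_empty this
        have hqz : q = 0 := hB1 fun h => by
          have := (hA0.add h).mono (bitSlice_add_bitSlice_subset A B 0 1)
          rw [zero_add, hy'] at this
          exact Finset.not_nonempty_empty this
        rw [hpz, hqz]
        ring)
    rw [← card_bitSlice (A + B)]
    push_cast
    linarith

theorem min_le_entropyForm_self_sub {u : ℝ} (hu : 0 ≤ u) (hu' : u ≤ Real.log 2) :
    min u (Real.log 2 - u) ≤ 29 * (entropyForm u u - u) := by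
  have hl : 0 < Real.log 2 := Real.log_pos one_lt_two
  have h : 29 * (entropyForm u u - u) = 2 * u * (Real.log 2 - u) / Real.log 2 := by
    rw [entropyForm]
    field_simp
    ring
  rw [h, le_div_iff₀ hl]
  rcases le_total u (Real.log 2 - u) with h1 | h1
  · rw [min_eq_left h1]
    nlinarith
  · rw [min_eq_right h1]
    nlinarith

/-- A shift-minimal downset of small doubling is dense in the coordinate subspace of about its
own size. -/
theorem two_pow_le_pow_mul_card_headPart {n : ℕ} {A : Finset (F2 n)} (hA₀ : A.Nonempty)
    (hA : IsDownset A) (hA' : IsShiftMinimal A) {K : ℝ} (hK : 1 ≤ K)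
    (hKA : ((A + A).card : ℝ) ≤ K * A.card) {m : ℕ} (hm : m ≤ n) (hmA : 2 ^ m ≤ A.card) :
    (2 : ℝ) ^ m ≤ K ^ 29 * (headPart m A).card := by
  set h := coordEntropy n A
  set d : ℕ → ℝ := fun i => entropyForm (h i) (h i) - h i with hd
  have hdmin (i : ℕ) : min (h i) (Real.log 2 - h i) ≤ 29 * d i :=
    min_le_entropyForm_self_sub (coordEntropy_nonneg A i) (coordEntropy_le_log_two A i)
  have hd0 (i : ℕ) : 0 ≤ d i := by
    have := (le_min (coordEntropy_nonneg A i)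
      (sub_nonneg.2 (coordEntropy_le_log_two A i))).trans (hdmin i)
    linarith
  have hc : (0 : ℝ) < A.card := by exact_mod_cast hA₀.card_pos
  have hK0 : 0 < K := by linarith
  have hsum : ∑ i ∈ Finset.range n, d i ≤ Real.log K := by
    have h1 := sum_entropyForm_le_log_card_add hA hA hA₀ hA₀
    have h2 := Real.log_le_log (by exact_mod_cast (hA₀.add hA₀).card_pos) hKA
    rw [Real.log_mul hK0.ne' hc.ne'] at h2
    have h3 := sum_coordEntropy A
    rw [hd, Finset.sum_sub_distrib]
    linarith
  have hhead := hA.sum_coordEntropy_le hm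
  have hanti := coordEntropy_antitone hA hA'
  have hmain : m * Real.log 2 - ∑ i ∈ Finset.range m, h i ≤ 29 * Real.log K := by
    refine le_trans ?_ (mul_le_mul_of_nonneg_left hsum (by norm_num))
    rw [Finset.mul_sum]
    rcases le_total (Real.log 2 / 2) (h m) with hhm | hhm
    · calc m * Real.log 2 - ∑ i ∈ Finset.range m, h i
          = ∑ i ∈ Finset.range m, (Real.log 2 - h i) := by simp [Finset.sum_sub_distrib]
        _ ≤ ∑ i ∈ Finset.range m, 29 * d i := by
          refine Finset.sum_le_sum fun i hi => ?_
          have h1 : h m ≤ h i := hanti (Finset.mem_range.1 hi).le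
          rw [← min_eq_right (by linarith : Real.log 2 - h i ≤ h i)]
          exact hdmin i
        _ ≤ ∑ i ∈ Finset.range n, 29 * d i :=
          Finset.sum_le_sum_of_subset_of_nonneg (Finset.range_subset_range.2 hm)
            fun i _ _ => mul_nonneg (by norm_num) (hd0 i)
    · have h1 : m * Real.log 2 ≤ Real.log A.card := by
        rw [← Real.log_pow]
        exact Real.log_le_log (by positivity) (by exact_mod_cast hmA)
      rw [← sum_coordEntropy A] at h1
      calc m * Real.log 2 - ∑ i ∈ Finset.range m, h i
          ≤ ∑ i ∈ Finset.range n, h i - ∑ i ∈ Finset.range m, h i := by linarith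
        _ = ∑ i ∈ Finset.Ico m n, h i := (Finset.sum_Ico_eq_sub h hm).symm
        _ ≤ ∑ i ∈ Finset.Ico m n, 29 * d i := by
          refine Finset.sum_le_sum fun i hi => ?_
          have h2 : h i ≤ h m := hanti (Finset.mem_Ico.1 hi).1
          rw [← min_eq_left (by linarith : h i ≤ Real.log 2 - h i)]
          exact hdmin i
        _ ≤ ∑ i ∈ Finset.range n, 29 * d i := by
          refine Finset.sum_le_sum_of_subset_of_nonneg (fun i hi => ?_)
            fun i _ _ => mul_nonneg (by norm_num) (hd0 i)
          exact Finset.mem_range.2 (Finset.mem_Ico.1 hi).2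
  have hpos : (0 : ℝ) < (headPart m A).card := by
    exact_mod_cast Finset.card_pos.2 ⟨0, hA.zero_mem_headPart hA₀ m⟩
  rw [← Real.log_le_log_iff (by positivity) (by positivity), Real.log_mul (by positivity) hpos.ne',
    Real.log_pow, Real.log_pow]
  push_cast
  linarith

/-- The points of `A` with the first `m` coordinates set to zero. -/
def tailPart {n : ℕ} (m : ℕ) (A : Finset (F2 n)) : Finset (F2 n) :=
  A.image fun x i => if (i : ℕ) < m then 0 else x i

theorem IsDownset.card_tailPart_mul_card_headPart_le {n : ℕ} {A : Finset (F2 n)}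
    (hA : IsDownset A) (m : ℕ) :
    (tailPart m A).card * (headPart m A).card ≤ (A + A).card := by
  rw [← Finset.card_product]
  refine Finset.card_le_card_of_injOn (fun z => z.1 + z.2) ?_ ?_
  · rintro ⟨t, y⟩ hz
    obtain ⟨ht, hy⟩ := Finset.mem_product.1 hz
    obtain ⟨x, hx, rfl⟩ := Finset.mem_image.1 ht
    refine Finset.add_mem_add ?_ (Finset.mem_filter.1 hy).1
    simpa using hA.zero_on_mem hx (Finset.univ.filter fun i : Fin n => (i : ℕ) < m)
  · rintro ⟨t, y⟩ hz ⟨t', y'⟩ hz' h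
    obtain ⟨ht, hy⟩ := Finset.mem_product.1 hz
    obtain ⟨ht', hy'⟩ := Finset.mem_product.1 hz'
    obtain ⟨x, -, rfl⟩ := Finset.mem_image.1 ht
    obtain ⟨x', -, rfl⟩ := Finset.mem_image.1 ht'
    have hy1 := (Finset.mem_filter.1 hy).2
    have hy1' := (Finset.mem_filter.1 hy').2
    have htt : (fun i : Fin n => if (i : ℕ) < m then 0 else x i)
        = fun i : Fin n => if (i : ℕ) < m then 0 else x' i := by
      funext i
      by_cases hi : (i : ℕ) < m
      · simp [hi]
      · have hyi : y i = 0 := hy1 i (not_lt.1 hi)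
        have hyi' : y' i = 0 := hy1' i (not_lt.1 hi)
        simpa [hi, hyi, hyi'] using congrFun h i
    simp only [htt] at h
    exact Prod.ext htt (add_left_cancel h)

/-- PFR for shift-minimal downsets (Theorem 1.10): a nonempty SMD `A` with
`|A+A| ≤ K|A|` is covered by `O(K^30)` translates of the coordinate subspace
`F_2^m` with `m = ⌊log₂ |A|⌋`. -/
theorem pfr_smd :
    ∃ C : ℝ, 0 ≤ C ∧
      ∀ (n : ℕ) (A : Finset (F2 n)), A.Nonempty → IsDownset A → IsShiftMinimal A →
        ∀ K : ℝ, 1 ≤ K → ((A + A).card : ℝ) ≤ K * A.card →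
        ∃ T : Finset (F2 n), (T.card : ℝ) ≤ C * K ^ (30 : ℕ) ∧
          ∀ x ∈ A, ∃ t ∈ T, ∀ i : Fin n, Nat.log 2 A.card ≤ (i : ℕ) → (x + t) i = 0 := by
  refine ⟨2, by norm_num, fun n A hA₀ hA hA' K hK hKA => ?_⟩
  set m := Nat.log 2 A.card
  refine ⟨tailPart m A, ?_, fun x hx => ⟨_, Finset.mem_image_of_mem _ hx, fun i hi => ?_⟩⟩
  · have hmA : 2 ^ m ≤ A.card := Nat.pow_log_le_self 2 hA₀.card_pos.ne'
    have hmn : m ≤ n := by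
      refine (Nat.pow_le_pow_iff_right one_lt_two).1 (hmA.trans ?_)
      simpa using Finset.card_le_univ A
    have hlt : (A.card : ℝ) ≤ 2 * 2 ^ m := by
      have := Nat.lt_pow_succ_log_self one_lt_two A.card
      rw [pow_succ'] at this
      exact_mod_cast this.le
    have hdense := two_pow_le_pow_mul_card_headPart hA₀ hA hA' hK hKA hmn hmA
    have hprod : ((tailPart m A).card : ℝ) * (headPart m A).card ≤ (A + A).card := by
      exact_mod_cast hA.card_tailPart_mul_card_headPart_le m
    have hpos : (0 : ℝ) < (headPart m A).card := by
      exact_mod_cast Finset.card_pos.2 ⟨0, hA.zero_mem_headPart hA₀ m⟩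
    refine le_of_mul_le_mul_right ?_ hpos
    calc ((tailPart m A).card : ℝ) * (headPart m A).card
        ≤ K * A.card := hprod.trans hKA
      _ ≤ K * (2 * (K ^ 29 * (headPart m A).card)) :=
        mul_le_mul_of_nonneg_left (by linarith) (by linarith)
      _ = 2 * K ^ 30 * (headPart m A).card := by ring
  · simp [not_lt.2 hi, CharTwo.add_self_eq_zero]
end

section
/- There is an absolute constant C ≥ 0 with the following property: if A ⊆ F_2^n is a nonempty downset and K ≥ 1 is a real number with |A + A| ≤ K·|A|, then there exist a subset J ⊆ {1, …, n} with 2^|J| ≤ |A| and a finite set T ⊆ F_2^n with |T| ≤ C·K^46 such that A ⊆ ⋃_{t ∈ T} (t + V_J), where V_J := {x ∈ F_2^n : x_i = 0 for all i ∉ J} is the coordinate subspace indexed by J. -/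
open Finset Pointwise

/-- The entropy, in bits, of a Bernoulli variable of parameter `p`. -/
noncomputable def bitEntropy (p : ℝ) : ℝ := Real.binEntropy p / Real.log 2

lemma bitEntropy_zero : bitEntropy 0 = 0 := by simp [bitEntropy]

lemma bitEntropy_nonneg {p : ℝ} (h0 : 0 ≤ p) (h1 : p ≤ 1) : 0 ≤ bitEntropy p :=
  div_nonneg (Real.binEntropy_nonneg h0 h1) (Real.log_nonneg (by norm_num))

lemma bitEntropy_le_one (p : ℝ) : bitEntropy p ≤ 1 :=
  div_le_one_of_le₀ Real.binEntropy_le_log_two (Real.log_nonneg (by norm_num))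

lemma bitEntropy_half : bitEntropy 2⁻¹ = 1 := by
  rw [bitEntropy, Real.binEntropy_two_inv, div_self (Real.log_pos (by norm_num)).ne']

lemma bitEntropy_mono {p q : ℝ} (h0 : 0 ≤ q) (hqp : q ≤ p) (hp : p ≤ 2⁻¹) :
    bitEntropy q ≤ bitEntropy p :=
  div_le_div_of_nonneg_right
    (Real.binEntropy_strictMonoOn.monotoneOn ⟨h0, hqp.trans hp⟩ ⟨h0.trans hqp, hp⟩ hqp)
    (Real.log_nonneg (by norm_num))

lemma bitEntropy_lineMap_half {p t : ℝ} (hp0 : 0 ≤ p) (hp1 : p ≤ 1) (ht0 : 0 ≤ t) (ht1 : t ≤ 1) :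
    (1 - t) * bitEntropy p + t ≤ bitEntropy ((1 - t) * p + t * 2⁻¹) := by
  have hc := Real.strictConcave_binEntropy.concaveOn.2 (x := p) (y := 2⁻¹) ⟨hp0, hp1⟩
    (by norm_num) (sub_nonneg.2 ht1) ht0 (by ring)
  have h2 : 0 < Real.log 2 := Real.log_pos (by norm_num)
  rw [Real.binEntropy_two_inv] at hc
  simp only [smul_eq_mul] at hc
  rw [bitEntropy, bitEntropy, le_div_iff₀ h2]
  calc _ = (1 - t) * Real.binEntropy p + t * Real.log 2 := by field_simp
    _ ≤ _ := hc

lemma five_mul_le_bitEntropy {p : ℝ} (h0 : 0 ≤ p) (h1 : p ≤ 1 / 32) : 5 * p ≤ bitEntropy p := by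
  have h2 : 0 < Real.log 2 := Real.log_pos (by norm_num)
  rcases h0.eq_or_lt with rfl | h0
  · simp [bitEntropy]
  rw [bitEntropy, le_div_iff₀ h2, Real.binEntropy]
  have hlog : 5 * Real.log 2 ≤ Real.log p⁻¹ := by
    rw [← Real.log_rpow (by norm_num)]
    apply Real.log_le_log (by positivity)
    rw [le_inv_comm₀ (by positivity) h0]
    norm_num at h1 ⊢
    exact h1
  have h3 : 0 ≤ (1 - p) * Real.log (1 - p)⁻¹ :=
    mul_nonneg (by linarith) (Real.log_nonneg ((one_le_inv₀ (by linarith)).2 (by linarith)))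
  nlinarith

lemma bitEntropy_le_twenty_mul {q : ℝ} (h0 : 1 / 1024 ≤ q) (h1 : q ≤ 2⁻¹) :
    bitEntropy q ≤ 20 * q := by
  have h2 : 0 < Real.log 2 := Real.log_pos (by norm_num)
  have hq : 0 < q := by linarith
  have hq1 : 0 < 1 - q := by norm_num at h1; linarith
  rw [bitEntropy, div_le_iff₀ h2, Real.binEntropy]
  have hlog : Real.log q⁻¹ ≤ 10 * Real.log 2 := by
    rw [← Real.log_rpow (by norm_num)]
    apply Real.log_le_log (by positivity)
    rw [inv_le_comm₀ hq (by positivity)]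
    norm_num at h0 ⊢
    exact h0
  have h3 : (1 - q) * Real.log (1 - q)⁻¹ ≤ q := by
    calc _ ≤ (1 - q) * ((1 - q)⁻¹ - 1) :=
          mul_le_mul_of_nonneg_left (Real.log_le_sub_one_of_pos (by positivity)) hq1.le
      _ = q := by field_simp; ring
  nlinarith [Real.log_two_gt_d9]

/-- The disjunction of two independent Bernoulli variables determines them up to
three possibilities whenever it holds. -/
lemma bitEntropy_add_le {p q : ℝ} (hp0 : 0 ≤ p) (hp1 : p ≤ 1) (hq0 : 0 ≤ q) (hq1 : q ≤ 1) :
    bitEntropy p + bitEntropy q ≤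
      bitEntropy (p + q - p * q) + (p + q - p * q) * Real.logb 2 3 := by
  have h2 : 0 < Real.log 2 := Real.log_pos (by norm_num)
  have hp1' := sub_nonneg.2 hp1
  have hq1' := sub_nonneg.2 hq1
  have key := Real.concaveOn_negMulLog.le_map_sum (t := Finset.univ (α := Fin 3)) (w := fun _ => (1 / 3 : ℝ))
    (p := ![p * q, p * (1 - q), (1 - p) * q]) (by intros; norm_num) (by norm_num) (by
      intro i _
      fin_cases i <;> simp <;> positivity)
  simp only [Fin.sum_univ_three, smul_eq_mul, Matrix.cons_val_zero, Matrix.cons_val_one,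
    Matrix.cons_val] at key
  have e1 : 1 / 3 * (p * q) + 1 / 3 * (p * (1 - q)) + 1 / 3 * ((1 - p) * q)
      = (1 / 3) * (p + q - p * q) := by ring
  have e2 : Real.negMulLog (1 / 3) = 1 / 3 * Real.log 3 := by
    rw [Real.negMulLog, one_div, Real.log_inv]; ring
  have e3 : 1 - (p + q - p * q) = (1 - p) * (1 - q) := by ring
  rw [e1] at key
  simp only [bitEntropy, Real.logb, Real.binEntropy_eq_negMulLog_add_negMulLog_one_sub]
  rw [e3, ← mul_div_assoc, ← add_div, ← add_div]
  refine div_le_div_of_nonneg_right ?_ h2.le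
  simp only [Real.negMulLog_mul, e2] at key ⊢
  linarith

lemma exists_bitEntropy_gain {p q : ℝ} (hq0 : 0 ≤ q) (hqp : q ≤ p) (hp : p ≤ 2⁻¹) :
    ∃ r, 0 ≤ r ∧ r ≤ p + q - p * q ∧
      1 / 2 * (bitEntropy p + bitEntropy q) +
        1 / 45 * (bitEntropy p + bitEntropy q - 2 * bitEntropy p * bitEntropy q)
        ≤ bitEntropy r := by
  have hp' : p ≤ 1 / 2 := by norm_num at hp ⊢; exact hp
  have hp0 := hq0.trans hqp
  have hu0 := bitEntropy_nonneg hp0 (by linarith)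
  have hu1 := bitEntropy_le_one p
  have hv0 := bitEntropy_nonneg hq0 (by linarith)
  have hvu := bitEntropy_mono hq0 hqp hp
  rcases le_or_gt (1 / 1024) q with hq | hq
  · refine ⟨(1 - q) * p + q * 2⁻¹, by nlinarith, by nlinarith,
      le_trans ?_ (bitEntropy_lineMap_half hp0 (by linarith) hq0 (by linarith))⟩
    have hv := bitEntropy_le_twenty_mul hq (hqp.trans hp)
    nlinarith [mul_nonneg (sub_nonneg.2 hv) (sub_nonneg.2 hu1),
      mul_nonneg (sub_nonneg.2 hvu) (sub_nonneg.2 hu1), mul_nonneg (sub_nonneg.2 hvu) hu0]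
  rcases le_or_gt p (1 / 32) with hp2 | hp2
  · refine ⟨p + q - p * q, by nlinarith, le_rfl, ?_⟩
    have hadd := bitEntropy_add_le hp0 (by linarith) hq0 (by linarith)
    have h3 : Real.logb 2 3 ≤ 8 / 5 := by
      rw [Real.logb_le_iff_le_rpow (by norm_num) (by norm_num)]
      refine le_of_pow_le_pow_left₀ (n := 5) (by norm_num) (by positivity) ?_
      rw [← Real.rpow_natCast, ← Real.rpow_natCast, ← Real.rpow_mul (by norm_num)]
      norm_num
    have hm : (p + q - p * q) * Real.logb 2 3 ≤ (p + q) * (8 / 5) :=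
      mul_le_mul (by nlinarith) h3 (Real.logb_nonneg (by norm_num) (by norm_num)) (by linarith)
    nlinarith [five_mul_le_bitEntropy hp0 hp2, five_mul_le_bitEntropy hq0 (by linarith),
      mul_nonneg hu0 hv0]
  · refine ⟨p, hp0, by nlinarith, ?_⟩
    have h1 := bitEntropy_mono (by norm_num) hp2.le hp
    have h2 := bitEntropy_mono hq0 hq.le (by norm_num)
    have h3 := five_mul_le_bitEntropy (p := 1 / 32) (by norm_num) (by norm_num)
    have h4 := bitEntropy_le_twenty_mul (q := 1 / 1024) (by norm_num) (by norm_num)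
    nlinarith [mul_nonneg hu0 hv0]

/-- Chain rule for the entropy of a set split into two parts. -/
lemma logb_add_eq {a b : ℝ} (ha : 0 < a) (hb : 0 < b) :
    Real.logb 2 (a + b) = bitEntropy (b / (a + b)) +
      ((1 - b / (a + b)) * Real.logb 2 a + b / (a + b) * Real.logb 2 b) := by
  have h2 : 0 < Real.log 2 := Real.log_pos (by norm_num)
  have e : 1 - b / (a + b) = a / (a + b) := by field_simp; ring
  rw [bitEntropy, Real.binEntropy, e]
  simp only [Real.logb, inv_div]
  rw [Real.log_div (by positivity) (by positivity), Real.log_div (by positivity) (by positivity)]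
  field_simp
  ring

lemma bitEntropy_add_le_logb {a b r : ℝ} (ha : 0 < a) (hb : 0 < b) (hr0 : 0 ≤ r) (hr1 : r ≤ 1) :
    bitEntropy r + ((1 - r) * Real.logb 2 a + r * Real.logb 2 b) ≤ Real.logb 2 (a + b) := by
  have h2 : 0 < Real.log 2 := Real.log_pos (by norm_num)
  rcases hr0.eq_or_lt with rfl | hr0
  · simp only [bitEntropy_zero, sub_zero, one_mul, zero_mul, add_zero, zero_add]
    exact Real.logb_le_logb_of_le (by norm_num) ha (by linarith)
  rcases hr1.eq_or_lt with rfl | hr1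
  · simp only [bitEntropy, Real.binEntropy_one, zero_div, sub_self, zero_mul, one_mul, zero_add]
    exact Real.logb_le_logb_of_le (by norm_num) hb (by linarith)
  have hr1' : 0 < 1 - r := by linarith
  have hc := strictConcaveOn_log_Ioi.concaveOn.2 (x := a / (1 - r)) (y := b / r)
    (Set.mem_Ioi.2 (by positivity)) (Set.mem_Ioi.2 (by positivity)) hr1'.le hr0.le (by ring)
  simp only [smul_eq_mul] at hc
  rw [mul_div_cancel₀ _ hr1'.ne', mul_div_cancel₀ _ hr0.ne', Real.log_div ha.ne' hr1'.ne',
    Real.log_div hb.ne' hr0.ne'] at hc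
  simp only [Real.logb, bitEntropy, Real.binEntropy, Real.log_inv]
  rw [← mul_div_assoc, ← mul_div_assoc, ← add_div, ← add_div]
  refine div_le_div_of_nonneg_right ?_ h2.le
  linarith

lemma IsDownset.mem_of_forall {n : ℕ} {A : Finset (F2 n)} (hA : IsDownset A) {x y : F2 n}
    (hx : x ∈ A) (hy : ∀ i, y i = 0 ∨ y i = x i) : y ∈ A := by
  have hpw : ∀ S : Finset (Fin n), S.piecewise 0 x ∈ A := by
    intro S
    induction S using Finset.induction_on with
    | empty => simpa using hx
    | insert i S _ ih =>
      rw [Finset.piecewise_insert]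
      rcases eq_or_ne (S.piecewise 0 x i) 0 with h | h
      · rwa [Pi.zero_apply, ← h, Function.update_eq_self]
      · refine hA _ i (by simp) ?_
        convert ih using 1
        ext j
        rcases eq_or_ne j i with rfl | hj
        · have : ∀ a : ZMod 2, a ≠ 0 → a = 1 := by decide
          simp [stdBasis, this _ h]
        · simp [stdBasis, hj]
  convert hpw (Finset.univ.filter fun i => y i = 0) using 1
  ext i
  by_cases h : y i = 0
  · simp [Finset.piecewise, h]
  · simp [Finset.piecewise, (hy i).resolve_left h]

/-- The slice of `A` on which the first coordinate equals `b`. -/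
def headSlice {n : ℕ} (b : ZMod 2) (A : Finset (F2 (n + 1))) : Finset (F2 n) :=
  Finset.univ.filter fun x => (Fin.cons b x : F2 (n + 1)) ∈ A

section HeadSlice

variable {n : ℕ} {A B : Finset (F2 (n + 1))}

lemma mem_headSlice {b : ZMod 2} {x : F2 n} :
    x ∈ headSlice b A ↔ (Fin.cons b x : F2 (n + 1)) ∈ A := by
  simp [headSlice]

lemma card_eq_card_headSlice_add (A : Finset (F2 (n + 1))) :
    A.card = (headSlice 0 A).card + (headSlice 1 A).card := by
  have hinj : ∀ b : ZMod 2, Function.Injective fun x : F2 n => (Fin.cons b x : F2 (n + 1)) :=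
    fun b => Fin.cons_right_injective (α := fun _ => ZMod 2) b
  rw [← Finset.card_image_of_injective (headSlice 0 A) (hinj 0),
    ← Finset.card_image_of_injective (headSlice 1 A) (hinj 1), ← Finset.card_union_of_disjoint]
  · congr 1
    ext x
    have h01 : ∀ a : ZMod 2, a = 0 ∨ a = 1 := by decide
    simp only [Finset.mem_union, Finset.mem_image, mem_headSlice]
    constructor
    · intro hx
      rcases h01 (x 0) with h | h
      · exact Or.inl ⟨Fin.tail x, by rwa [← h, Fin.cons_self_tail],
          by rw [← h, Fin.cons_self_tail]⟩
      · exact Or.inr ⟨Fin.tail x, by rwa [← h, Fin.cons_self_tail],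
          by rw [← h, Fin.cons_self_tail]⟩
    · rintro (⟨y, hy, rfl⟩ | ⟨y, hy, rfl⟩) <;> exact hy
  · rw [Finset.disjoint_left]
    intro x hx hx'
    obtain ⟨y, -, rfl⟩ := Finset.mem_image.1 hx
    obtain ⟨z, -, hz⟩ := Finset.mem_image.1 hx'
    simpa using congrFun hz 0

lemma IsDownset.isDownset_headSlice (hA : IsDownset A) (b : ZMod 2) :
    IsDownset (headSlice b A) := by
  intro x i _ hx
  rw [mem_headSlice] at hx ⊢
  refine hA.mem_of_forall hx fun j => ?_
  refine Fin.cases (Or.inr rfl) (fun k => ?_) j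
  rcases eq_or_ne k i with rfl | hk
  · left; simpa
  · right; simp [stdBasis, hk]

lemma IsDownset.headSlice_one_subset (hA : IsDownset A) : headSlice 1 A ⊆ headSlice 0 A := by
  intro x hx
  rw [mem_headSlice] at hx ⊢
  exact hA.mem_of_forall hx (Fin.cases (Or.inl rfl) fun k => Or.inr rfl)

lemma headSlice_zero_nonempty (hA : IsDownset A) (hne : A.Nonempty) : (headSlice 0 A).Nonempty := by
  rw [Finset.nonempty_iff_ne_empty]
  intro h
  have h1 : headSlice 1 A = ∅ := Finset.subset_empty.1 (h ▸ hA.headSlice_one_subset)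
  have := card_eq_card_headSlice_add A
  rw [h, h1] at this
  simp [hne.ne_empty] at this

lemma headSlice_add_headSlice_subset (b c : ZMod 2) :
    headSlice b A + headSlice c B ⊆ headSlice (b + c) (A + B) := by
  intro z hz
  obtain ⟨x, hx, y, hy, rfl⟩ := Finset.mem_add.1 hz
  rw [mem_headSlice] at hx hy ⊢
  convert Finset.add_mem_add hx hy using 1
  ext i
  refine Fin.cases rfl (fun k => rfl) i

end HeadSlice

/-- The probability that the first coordinate of a uniformly random element of `A` is `1`. -/
noncomputable def headProb {n : ℕ} (A : Finset (F2 (n + 1))) : ℝ :=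
  ((headSlice 1 A).card : ℝ) / A.card

lemma headProb_nonneg {n : ℕ} (A : Finset (F2 (n + 1))) : 0 ≤ headProb A := by
  unfold headProb; positivity

lemma headProb_le_one {n : ℕ} (A : Finset (F2 (n + 1))) : headProb A ≤ 1 := by
  refine div_le_one_of_le₀ ?_ (by positivity)
  exact_mod_cast (card_eq_card_headSlice_add A).symm ▸ Nat.le_add_left _ _

lemma headProb_le_half {n : ℕ} {A : Finset (F2 (n + 1))} (hA : IsDownset A) :
    headProb A ≤ 2⁻¹ := by
  have h := Finset.card_le_card hA.headSlice_one_subset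
  rcases A.eq_empty_or_nonempty with rfl | hne
  · simp [headProb]
  rw [headProb, div_le_iff₀ (by exact_mod_cast hne.card_pos), card_eq_card_headSlice_add A]
  have : ((headSlice 1 A).card : ℝ) ≤ (headSlice 0 A).card := by exact_mod_cast h
  push_cast
  linarith

lemma headProb_eq_zero_of_headSlice_eq_empty {n : ℕ} {A : Finset (F2 (n + 1))}
    (h : headSlice 1 A = ∅) : headProb A = 0 := by
  simp [headProb, h]

/-- `condEntropy n A i` is the entropy, in bits, of the `i`-th coordinate of a uniformly random
element of `A`, conditioned on the preceding coordinates. -/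
noncomputable def condEntropy : (n : ℕ) → Finset (F2 n) → Fin n → ℝ
  | 0, _ => Fin.elim0
  | n + 1, A => Fin.cons (bitEntropy (headProb A)) fun i =>
      (1 - headProb A) * condEntropy n (headSlice 0 A) i +
        headProb A * condEntropy n (headSlice 1 A) i

lemma condEntropy_zero {n : ℕ} (A : Finset (F2 (n + 1))) :
    condEntropy (n + 1) A 0 = bitEntropy (headProb A) := rfl

lemma condEntropy_succ {n : ℕ} (A : Finset (F2 (n + 1))) (i : Fin n) :
    condEntropy (n + 1) A i.succ = (1 - headProb A) * condEntropy n (headSlice 0 A) i +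
      headProb A * condEntropy n (headSlice 1 A) i := rfl

lemma condEntropy_mem_Icc : ∀ {n : ℕ} (A : Finset (F2 n)) (i : Fin n),
    condEntropy n A i ∈ Set.Icc (0 : ℝ) 1
  | 0, _, i => i.elim0
  | n + 1, A, i => by
    refine Fin.cases ?_ (fun i => ?_) i
    · exact ⟨bitEntropy_nonneg (headProb_nonneg A) (headProb_le_one A), bitEntropy_le_one _⟩
    · exact convex_Icc (0 : ℝ) 1 (condEntropy_mem_Icc (headSlice 0 A) i)
        (condEntropy_mem_Icc (headSlice 1 A) i) (sub_nonneg.2 (headProb_le_one A))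
        (headProb_nonneg A) (by ring)

lemma logb_natCast_mono {a b : ℕ} (h : a ≤ b) : Real.logb 2 a ≤ Real.logb 2 b := by
  rcases a.eq_zero_or_pos with rfl | ha
  · rw [Nat.cast_zero, Real.logb_zero]
    rcases b.eq_zero_or_pos with rfl | hb
    · simp
    · exact Real.logb_nonneg (by norm_num) (by exact_mod_cast hb)
  · exact Real.logb_le_logb_of_le (by norm_num) (by exact_mod_cast ha) (by exact_mod_cast h)

lemma logb_card_succ {n : ℕ} {A : Finset (F2 (n + 1))} (hA : IsDownset A) (hne : A.Nonempty) :
    Real.logb 2 A.card = bitEntropy (headProb A) + ((1 - headProb A) *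
      Real.logb 2 (headSlice 0 A).card + headProb A * Real.logb 2 (headSlice 1 A).card) := by
  have h0 := (headSlice_zero_nonempty hA hne).card_pos
  rcases (headSlice 1 A).eq_empty_or_nonempty with h | h
  · rw [headProb_eq_zero_of_headSlice_eq_empty h, card_eq_card_headSlice_add A, h]
    simp [bitEntropy_zero]
  · have h1 := h.card_pos
    have := logb_add_eq (a := (headSlice 0 A).card) (b := (headSlice 1 A).card)
      (by exact_mod_cast h0) (by exact_mod_cast h1)
    rw [headProb, card_eq_card_headSlice_add A]
    exact_mod_cast this

/-- The chain rule for entropy. -/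
lemma logb_card_eq_sum_condEntropy : ∀ {n : ℕ} {A : Finset (F2 n)}, IsDownset A → A.Nonempty →
    Real.logb 2 A.card = ∑ i, condEntropy n A i
  | 0, A, _, hne => by
    have : A.card = 1 := le_antisymm (Finset.card_le_one_of_subsingleton A) hne.card_pos
    simp [this]
  | n + 1, A, hA, hne => by
    rw [logb_card_succ hA hne, Fin.sum_univ_succ, condEntropy_zero]
    simp only [condEntropy_succ]
    rw [Finset.sum_add_distrib, ← Finset.mul_sum, ← Finset.mul_sum,
      ← logb_card_eq_sum_condEntropy (hA.isDownset_headSlice 0) (headSlice_zero_nonempty hA hne)]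
    rcases (headSlice 1 A).eq_empty_or_nonempty with h | h
    · simp [headProb_eq_zero_of_headSlice_eq_empty h]
    · rw [← logb_card_eq_sum_condEntropy (hA.isDownset_headSlice 1) h]

/-- The elements of `A` supported on `J`. -/
def supportedOn {n : ℕ} (A : Finset (F2 n)) (J : Finset (Fin n)) : Finset (F2 n) :=
  A.filter fun x => ∀ i ∉ J, x i = 0

lemma mem_supportedOn {n : ℕ} {A : Finset (F2 n)} {J : Finset (Fin n)} {x : F2 n} :
    x ∈ supportedOn A J ↔ x ∈ A ∧ ∀ i ∉ J, x i = 0 := by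
  simp [supportedOn]

lemma IsDownset.supportedOn_nonempty {n : ℕ} {A : Finset (F2 n)} (hA : IsDownset A)
    (hne : A.Nonempty) (J : Finset (Fin n)) : (supportedOn A J).Nonempty := by
  obtain ⟨x, hx⟩ := hne
  exact ⟨0, mem_supportedOn.2 ⟨hA.mem_of_forall hx fun _ => Or.inl rfl, fun _ _ => rfl⟩⟩

/-- Conditioning on more coordinates decreases entropy. -/
lemma sum_condEntropy_le_logb_card_supportedOn : ∀ {n : ℕ} {A : Finset (F2 n)}, IsDownset A →
    A.Nonempty → ∀ J : Finset (Fin n),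
      ∑ i ∈ J, condEntropy n A i ≤ Real.logb 2 (supportedOn A J).card
  | 0, A, hA, hne, J => by
    rw [Finset.eq_empty_of_isEmpty J, Finset.sum_empty]
    exact Real.logb_nonneg (by norm_num)
      (by exact_mod_cast (hA.supportedOn_nonempty hne _).card_pos)
  | n + 1, A, hA, hne, J => by
    set J' : Finset (Fin n) := Finset.univ.filter fun i => i.succ ∈ J with hJ'
    have ih0 := sum_condEntropy_le_logb_card_supportedOn (hA.isDownset_headSlice 0)
      (headSlice_zero_nonempty hA hne) J'
    have ih1 : headProb A * ∑ i ∈ J', condEntropy n (headSlice 1 A) i ≤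
        headProb A * Real.logb 2 (supportedOn (headSlice 1 A) J').card := by
      rcases (headSlice 1 A).eq_empty_or_nonempty with h | h
      · simp [headProb_eq_zero_of_headSlice_eq_empty h]
      · exact mul_le_mul_of_nonneg_left
          (sum_condEntropy_le_logb_card_supportedOn (hA.isDownset_headSlice 1) h J')
          (headProb_nonneg A)
    have hp0 := headProb_nonneg A
    have hp1 := headProb_le_one A
    have ih0' := mul_le_mul_of_nonneg_left ih0 (sub_nonneg.2 hp1)
    have hsum : ∑ i ∈ J, condEntropy (n + 1) A i =
        (if (0 : Fin (n + 1)) ∈ J then bitEntropy (headProb A) else 0) +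
          ((1 - headProb A) * ∑ i ∈ J', condEntropy n (headSlice 0 A) i +
            headProb A * ∑ i ∈ J', condEntropy n (headSlice 1 A) i) := by
      have hfilter : J = Finset.univ.filter (· ∈ J) := by simp
      rw [hfilter, Finset.sum_filter, Fin.sum_univ_succ, Finset.mul_sum, Finset.mul_sum,
        ← Finset.sum_add_distrib, hJ', Finset.sum_filter]
      simp [condEntropy_zero, condEntropy_succ]
    have hs0 : headSlice 0 (supportedOn A J) = supportedOn (headSlice 0 A) J' := by
      ext x
      simp [mem_headSlice, mem_supportedOn, Fin.forall_fin_succ, hJ']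
    have hpos0 := ((hA.isDownset_headSlice 0).supportedOn_nonempty
      (headSlice_zero_nonempty hA hne) J').card_pos
    rw [hsum]
    split_ifs with h0
    · have hs1 : headSlice 1 (supportedOn A J) = supportedOn (headSlice 1 A) J' := by
        ext x
        simp [mem_headSlice, mem_supportedOn, Fin.forall_fin_succ, hJ', h0]
      rw [card_eq_card_headSlice_add (supportedOn A J), hs0, hs1]
      rcases (headSlice 1 A).eq_empty_or_nonempty with h | h
      · have : supportedOn (headSlice 1 A) J' = ∅ := by simp [supportedOn, h]
        simpa [headProb_eq_zero_of_headSlice_eq_empty h, bitEntropy_zero, this] using ih0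
      · have hpos1 := ((hA.isDownset_headSlice 1).supportedOn_nonempty h J').card_pos
        have := bitEntropy_add_le_logb (a := (supportedOn (headSlice 0 A) J').card)
          (b := (supportedOn (headSlice 1 A) J').card) (by exact_mod_cast hpos0)
          (by exact_mod_cast hpos1) hp0 hp1
        push_cast
        linarith
    · have hle : (supportedOn (headSlice 1 A) J').card ≤ (supportedOn (headSlice 0 A) J').card :=
        Finset.card_le_card (Finset.filter_subset_filter _ hA.headSlice_one_subset)
      have hle2 : (supportedOn (headSlice 0 A) J').card ≤ (supportedOn A J).card := by
        rw [card_eq_card_headSlice_add (supportedOn A J), hs0]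
        exact Nat.le_add_right _ _
      have h1 := mul_le_mul_of_nonneg_left (logb_natCast_mono hle) hp0
      have h2 := logb_natCast_mono hle2
      linarith

/-- Entropy increment for sumsets of downsets: the gain vanishes only if in each coordinate the
conditional entropies are both `0` or both `1`. -/
lemma logb_card_add_ge : ∀ {n : ℕ} {A B : Finset (F2 n)}, IsDownset A → IsDownset B →
    A.Nonempty → B.Nonempty →
    1 / 2 * (Real.logb 2 A.card + Real.logb 2 B.card) + 1 / 45 * ∑ i, (condEntropy n A i +
      condEntropy n B i - 2 * condEntropy n A i * condEntropy n B i) ≤ Real.logb 2 (A + B).card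
  | 0, A, B, _, _, hAne, hBne => by
    have hA1 : A.card = 1 := le_antisymm (Finset.card_le_one_of_subsingleton A) hAne.card_pos
    have hB1 : B.card = 1 := le_antisymm (Finset.card_le_one_of_subsingleton B) hBne.card_pos
    have hAB : (A + B).card = 1 :=
      le_antisymm (Finset.card_le_one_of_subsingleton _) (hAne.add hBne).card_pos
    simp [hA1, hB1, hAB]
  | n + 1, A, B, hA, hB, hAne, hBne => by
    set gain : Finset (F2 n) → Finset (F2 n) → ℝ := fun X Y => ∑ i, (condEntropy n X i +
      condEntropy n Y i - 2 * condEntropy n X i * condEntropy n Y i) with hgain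
    set p := headProb A with hp
    set q := headProb B with hq
    have hp0 : 0 ≤ p := headProb_nonneg A
    have hq0 : 0 ≤ q := headProb_nonneg B
    have hp2 : p ≤ 2⁻¹ := headProb_le_half hA
    have hq2 : q ≤ 2⁻¹ := headProb_le_half hB
    have hp1 : 0 ≤ 1 - p := sub_nonneg.2 (headProb_le_one A)
    have hq1 : 0 ≤ 1 - q := sub_nonneg.2 (headProb_le_one B)
    have hA0 := headSlice_zero_nonempty hA hAne
    have hB0 := headSlice_zero_nonempty hB hBne
    have ih00 := logb_card_add_ge (hA.isDownset_headSlice 0) (hB.isDownset_headSlice 0) hA0 hB0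
    have ih01 : (1 - p) * q * (1 / 2 * (Real.logb 2 (headSlice 0 A).card +
        Real.logb 2 (headSlice 1 B).card) + 1 / 45 * gain (headSlice 0 A) (headSlice 1 B)) ≤
        (1 - p) * q * Real.logb 2 (headSlice 0 A + headSlice 1 B).card := by
      rcases (headSlice 1 B).eq_empty_or_nonempty with h | h
      · simp [hq, headProb_eq_zero_of_headSlice_eq_empty h]
      · exact mul_le_mul_of_nonneg_left
          (logb_card_add_ge (hA.isDownset_headSlice 0) (hB.isDownset_headSlice 1) hA0 h)
          (by positivity)
    have ih10 : p * (1 - q) * (1 / 2 * (Real.logb 2 (headSlice 1 A).card +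
        Real.logb 2 (headSlice 0 B).card) + 1 / 45 * gain (headSlice 1 A) (headSlice 0 B)) ≤
        p * (1 - q) * Real.logb 2 (headSlice 1 A + headSlice 0 B).card := by
      rcases (headSlice 1 A).eq_empty_or_nonempty with h | h
      · simp [hp, headProb_eq_zero_of_headSlice_eq_empty h]
      · exact mul_le_mul_of_nonneg_left
          (logb_card_add_ge (hA.isDownset_headSlice 1) (hB.isDownset_headSlice 0) h hB0)
          (by positivity)
    have ih11 : p * q * (1 / 2 * (Real.logb 2 (headSlice 1 A).card +
        Real.logb 2 (headSlice 1 B).card) + 1 / 45 * gain (headSlice 1 A) (headSlice 1 B)) ≤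
        p * q * Real.logb 2 (headSlice 1 A + headSlice 1 B).card := by
      rcases (headSlice 1 A).eq_empty_or_nonempty with h | h
      · simp [hp, headProb_eq_zero_of_headSlice_eq_empty h]
      rcases (headSlice 1 B).eq_empty_or_nonempty with h' | h'
      · simp [hq, headProb_eq_zero_of_headSlice_eq_empty h']
      · exact mul_le_mul_of_nonneg_left
          (logb_card_add_ge (hA.isDownset_headSlice 1) (hB.isDownset_headSlice 1) h h')
          (by positivity)
    have hsA := hA.headSlice_one_subset
    have hsB := hB.headSlice_one_subset
    have s00 : headSlice 0 A + headSlice 0 B ⊆ headSlice 0 (A + B) := by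
      simpa using headSlice_add_headSlice_subset (A := A) (B := B) 0 0
    have s01 : headSlice 0 A + headSlice 1 B ⊆ headSlice 1 (A + B) := by
      simpa using headSlice_add_headSlice_subset (A := A) (B := B) 0 1
    have s10 : headSlice 1 A + headSlice 0 B ⊆ headSlice 1 (A + B) := by
      simpa using headSlice_add_headSlice_subset (A := A) (B := B) 1 0
    have mono {X Y : Finset (F2 n)} (h : X ⊆ Y) : Real.logb 2 X.card ≤ Real.logb 2 Y.card :=
      logb_natCast_mono (Finset.card_le_card h)
    have m00 := mono s00
    have m01 := mono ((Finset.add_subset_add_left hsB).trans s00)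
    have m10 := mono ((Finset.add_subset_add_right hsA).trans s00)
    have m11 := mono ((Finset.add_subset_add hsA hsB).trans s00)
    have m01' := mono s01
    have m10' := mono s10
    have m11' := mono ((Finset.add_subset_add_right hsA).trans s01)
    obtain ⟨r, hr0, hr1, hr⟩ : ∃ r, 0 ≤ r ∧ r ≤ p + q - p * q ∧
        1 / 2 * (bitEntropy p + bitEntropy q) +
          1 / 45 * (bitEntropy p + bitEntropy q - 2 * bitEntropy p * bitEntropy q)
          ≤ bitEntropy r := by
      rcases le_total q p with h | h
      · exact exists_bitEntropy_gain hq0 h hp2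
      · obtain ⟨r, h0, h1, h2⟩ := exists_bitEntropy_gain hp0 h hq2
        exact ⟨r, h0, by linarith, by linarith⟩
    have hS : bitEntropy r + ((1 - r) * Real.logb 2 (headSlice 0 (A + B)).card +
        r * Real.logb 2 (headSlice 1 (A + B)).card) ≤ Real.logb 2 (A + B).card := by
      have hpos0 := ((hA0.add hB0).mono s00).card_pos
      rw [card_eq_card_headSlice_add (A + B)]
      rcases (headSlice 1 (A + B)).eq_empty_or_nonempty with h | h
      · have hp' : p = 0 := headProb_eq_zero_of_headSlice_eq_empty <| by
          by_contra hne
          exact ((Finset.nonempty_iff_ne_empty.2 hne).add hB0).ne_empty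
            (Finset.subset_empty.1 (h ▸ s10))
        have hq' : q = 0 := headProb_eq_zero_of_headSlice_eq_empty <| by
          by_contra hne
          exact (hA0.add (Finset.nonempty_iff_ne_empty.2 hne)).ne_empty
            (Finset.subset_empty.1 (h ▸ s01))
        have hr' : r = 0 := le_antisymm (by simpa [hp', hq'] using hr1) hr0
        simp [hr', h, bitEntropy_zero]
      · have hpos1 := h.card_pos
        have := bitEntropy_add_le_logb (a := (headSlice 0 (A + B)).card)
          (b := (headSlice 1 (A + B)).card) (r := r) (by exact_mod_cast hpos0)
          (by exact_mod_cast hpos1) hr0 (by nlinarith)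
        exact_mod_cast this
    have hsum : ∑ i : Fin n, (condEntropy (n + 1) A i.succ + condEntropy (n + 1) B i.succ -
        2 * condEntropy (n + 1) A i.succ * condEntropy (n + 1) B i.succ) =
        (1 - p) * (1 - q) * gain (headSlice 0 A) (headSlice 0 B) +
        (1 - p) * q * gain (headSlice 0 A) (headSlice 1 B) +
        p * (1 - q) * gain (headSlice 1 A) (headSlice 0 B) +
        p * q * gain (headSlice 1 A) (headSlice 1 B) := by
      simp only [hgain, Finset.mul_sum, ← Finset.sum_add_distrib]
      refine Finset.sum_congr rfl fun i _ => ?_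
      rw [condEntropy_succ, condEntropy_succ, ← hp, ← hq]
      ring
    rw [logb_card_succ hA hAne, logb_card_succ hB hBne, Fin.sum_univ_succ, hsum,
      condEntropy_zero, condEntropy_zero, ← hp, ← hq]
    refine le_trans ?_ hS
    have ih00' := mul_le_mul_of_nonneg_left ih00 (mul_nonneg hp1 hq1)
    change (1 - p) * (1 - q) * (1 / 2 * (Real.logb 2 (headSlice 0 A).card +
        Real.logb 2 (headSlice 0 B).card) + 1 / 45 * gain (headSlice 0 A) (headSlice 0 B)) ≤
        _ at ih00'
    have hmin : ∀ {w m : ℝ}, 0 ≤ w → m ≤ Real.logb 2 (headSlice 0 (A + B)).card →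
        m ≤ Real.logb 2 (headSlice 1 (A + B)).card →
        w * m ≤ w * min (Real.logb 2 (headSlice 0 (A + B)).card)
          (Real.logb 2 (headSlice 1 (A + B)).card) :=
      fun hw h0 h1 => mul_le_mul_of_nonneg_left (le_min h0 h1) hw
    have k00 := mul_le_mul_of_nonneg_left m00 (mul_nonneg hp1 hq1)
    have k01 := hmin (mul_nonneg hp1 hq0) m01 m01'
    have k10 := hmin (mul_nonneg hp0 hq1) m10 m10'
    have k11 := hmin (mul_nonneg hp0 hq0) m11 m11'
    have l0 := mul_le_mul_of_nonneg_left (min_le_left (Real.logb 2 (headSlice 0 (A + B)).card)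
      (Real.logb 2 (headSlice 1 (A + B)).card)) (sub_nonneg.2 hr1)
    have l1 := mul_le_mul_of_nonneg_left (min_le_right (Real.logb 2 (headSlice 0 (A + B)).card)
      (Real.logb 2 (headSlice 1 (A + B)).card)) hr0
    linarith

/-- The vectors supported on `S`. -/
def coordSubspace {n : ℕ} (S : Finset (Fin n)) : Finset (F2 n) :=
  Fintype.piFinset fun i => if i ∈ S then Finset.univ else {0}

lemma card_coordSubspace {n : ℕ} (S : Finset (Fin n)) : (coordSubspace S).card = 2 ^ S.card := by
  have h : ∀ i, (if i ∈ S then (Finset.univ : Finset (ZMod 2)) else {0}).card =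
      if i ∈ S then 2 else 1 := by
    intro i; split_ifs <;> rfl
  rw [coordSubspace, Fintype.card_piFinset]
  simp only [h]
  rw [Finset.prod_ite_mem, Finset.univ_inter, Finset.prod_const]

lemma card_supportedOn_mul_le {n : ℕ} (A : Finset (F2 n)) (J : Finset (Fin n)) :
    (supportedOn A J).card * (supportedOn A Jᶜ).card ≤ (A + A).card := by
  rw [← Finset.card_add_iff.2]
  · exact Finset.card_le_card
      (Finset.add_subset_add (Finset.filter_subset _ _) (Finset.filter_subset _ _))
  · rintro ⟨x, y⟩ hxy ⟨x', y'⟩ hxy' h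
    obtain ⟨hx, hy⟩ := hxy
    obtain ⟨hx', hy'⟩ := hxy'
    have hx : ∀ i ∉ J, x i = 0 := (mem_supportedOn.1 hx).2
    have hy : ∀ i ∉ Jᶜ, y i = 0 := (mem_supportedOn.1 hy).2
    have hx' : ∀ i ∉ J, x' i = 0 := (mem_supportedOn.1 hx').2
    have hy' : ∀ i ∉ Jᶜ, y' i = 0 := (mem_supportedOn.1 hy').2
    have h : x + y = x' + y' := h
    have hxx : x = x' := by
      ext i
      by_cases hi : i ∈ J
      · simpa [hy i (by simpa), hy' i (by simpa)] using congrFun h i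
      · rw [hx i hi, hx' i hi]
    subst hxx
    rw [add_left_cancel h]

/-- A downset of small doubling is close to a coordinate subspace in cardinality. -/
lemma exists_coordinates {n : ℕ} {A : Finset (F2 n)} (hne : A.Nonempty) (hA : IsDownset A)
    {K : ℝ} (hK : 1 ≤ K) (hAK : ((A + A).card : ℝ) ≤ K * A.card) :
    ∃ J : Finset (Fin n), (A.card : ℝ) ≤ K ^ 45 * (supportedOn A J).card ∧
      (2 : ℝ) ^ J.card ≤ K ^ 45 * (supportedOn A J).card := by
  set U := condEntropy n A with hU
  have hU01 : ∀ i, 0 ≤ U i ∧ U i ≤ 1 := condEntropy_mem_Icc A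
  set J : Finset (Fin n) := Finset.univ.filter fun i => 1 / 2 ≤ U i with hJ
  have hApos : (0 : ℝ) < A.card := by exact_mod_cast hne.card_pos
  have hP : (0 : ℝ) < (supportedOn A J).card := by
    exact_mod_cast (hA.supportedOn_nonempty hne J).card_pos
  have hK0 : 0 < K := by linarith
  have hdouble : Real.logb 2 (A + A).card ≤ Real.logb 2 K + Real.logb 2 A.card := by
    rw [← Real.logb_mul hK0.ne' hApos.ne']
    exact Real.logb_le_logb_of_le (by norm_num) (by exact_mod_cast (hne.add hne).card_pos) hAK
  have hmain := logb_card_add_ge hA hA hne hne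
  have hgain : ∑ i, (U i + U i - 2 * U i * U i) ≤ 45 * Real.logb 2 K := by linarith
  rw [← Finset.sum_add_sum_compl J] at hgain
  have hJsum : ∑ i ∈ J, (1 - U i) ≤ ∑ i ∈ J, (U i + U i - 2 * U i * U i) := by
    refine Finset.sum_le_sum fun i hi => ?_
    have : 1 / 2 ≤ U i := by simpa [hJ] using hi
    nlinarith [hU01 i]
  have hJcsum : ∑ i ∈ Jᶜ, U i ≤ ∑ i ∈ Jᶜ, (U i + U i - 2 * U i * U i) := by
    refine Finset.sum_le_sum fun i hi => ?_
    have : U i < 1 / 2 := by simpa [hJ] using hi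
    nlinarith [hU01 i]
  have hJ0 : 0 ≤ ∑ i ∈ J, (1 - U i) := Finset.sum_nonneg fun i _ => sub_nonneg.2 (hU01 i).2
  have hJc0 : 0 ≤ ∑ i ∈ Jᶜ, U i := Finset.sum_nonneg fun i _ => (hU01 i).1
  have hsupp := sum_condEntropy_le_logb_card_supportedOn hA hne J
  have hlog : Real.logb 2 (K ^ 45 * (supportedOn A J).card) =
      45 * Real.logb 2 K + Real.logb 2 (supportedOn A J).card := by
    rw [Real.logb_mul (by positivity) hP.ne', Real.logb_pow]
    norm_num
  refine ⟨J, ?_, ?_⟩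
  · rw [← Real.logb_le_logb (b := 2) (by norm_num) hApos (by positivity), hlog,
      logb_card_eq_sum_condEntropy hA hne, ← Finset.sum_add_sum_compl J]
    linarith
  · rw [← Real.logb_le_logb (b := 2) (by norm_num) (by positivity) (by positivity), hlog,
      Real.logb_pow, Real.logb_self_eq_one (by norm_num)]
    rw [Finset.sum_sub_distrib] at hJsum hJ0
    simp only [Finset.sum_const, nsmul_eq_mul, mul_one] at hJsum hJ0 ⊢
    linarith

/-- PFR for downsets (Theorem 1.12 / 1.13): a nonempty downset `A` with
`|A+A| ≤ K|A|` is covered by `O(K^46)` translates of a coordinate subspace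
`V_J` of cardinality at most `|A|`. -/
theorem pfr_downset :
    ∃ C : ℝ, 0 ≤ C ∧
      ∀ (n : ℕ) (A : Finset (F2 n)), A.Nonempty → IsDownset A →
        ∀ K : ℝ, 1 ≤ K → ((A + A).card : ℝ) ≤ K * A.card →
        ∃ J : Finset (Fin n), 2 ^ J.card ≤ A.card ∧
          ∃ T : Finset (F2 n), (T.card : ℝ) ≤ C * K ^ (46 : ℕ) ∧
            ∀ x ∈ A, ∃ t ∈ T, ∀ i : Fin n, i ∉ J → (x + t) i = 0 := by
  refine ⟨2, by norm_num, fun n A hne hA K hK hAK => ?_⟩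
  obtain ⟨J, hJA, hJ⟩ := exists_coordinates hne hA hK hAK
  set P := supportedOn A J
  set Q := supportedOn A Jᶜ with hQ
  have hK0 : 0 < K := by linarith
  have hP : (0 : ℝ) < P.card := by exact_mod_cast (hA.supportedOn_nonempty hne J).card_pos
  have hPQ : (P.card * Q.card : ℝ) ≤ K * A.card :=
    le_trans (by exact_mod_cast card_supportedOn_mul_le A J) hAK
  have hproj : ∀ x ∈ A, J.piecewise 0 x ∈ Q := fun x hx =>
    mem_supportedOn.2 ⟨hA.mem_of_forall hx fun i => by by_cases h : i ∈ J <;> simp [h],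
      fun i hi => by simp at hi; simp [hi]⟩
  have hself : ∀ a : ZMod 2, a + a = 0 := by decide
  rcases le_or_gt (2 ^ J.card) A.card with hle | hlt
  · refine ⟨J, hle, Q, ?_, fun x hx => ⟨_, hproj x hx, fun i hi => by simp [hi, hself]⟩⟩
    refine le_of_mul_le_mul_left ?_ hP
    calc (P.card * Q.card : ℝ) ≤ K * (K ^ 45 * P.card) := hPQ.trans (by gcongr)
      _ = P.card * (1 * K ^ 46) := by ring
      _ ≤ P.card * (2 * K ^ 46) := by gcongr; norm_num
  · have hm := Nat.pow_log_le_self 2 hne.card_pos.ne'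
    have hm' := Nat.lt_pow_succ_log_self (b := 2) (by norm_num) A.card
    set m := Nat.log 2 A.card
    have hmJ : m ≤ J.card := (Nat.pow_lt_pow_iff_right (a := 2) (by norm_num)).1
      (hm.trans_lt hlt) |>.le
    obtain ⟨J', hJ'J, hJ'⟩ := Finset.exists_subset_card_eq hmJ
    refine ⟨J', by rwa [hJ'], Q + coordSubspace (J \ J'), ?_, fun x hx =>
      ⟨J.piecewise 0 x + (J \ J').piecewise x 0, Finset.add_mem_add (hproj x hx) ?_, ?_⟩⟩
    · have hcard : ((Q + coordSubspace (J \ J')).card : ℝ) ≤ Q.card * 2 ^ (J.card - m) := by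
        have := Finset.card_add_le (s := Q) (t := coordSubspace (J \ J'))
        rw [card_coordSubspace, Finset.card_sdiff_of_subset hJ'J, hJ'] at this
        exact_mod_cast this
      have hA2 : (A.card : ℝ) ≤ 2 ^ (m + 1) := by exact_mod_cast hm'.le
      refine le_of_mul_le_mul_left ?_ hP
      calc (P.card * (Q + coordSubspace (J \ J')).card : ℝ)
          ≤ P.card * (Q.card * 2 ^ (J.card - m)) := by gcongr
        _ = (P.card * Q.card) * 2 ^ (J.card - m) := by ring
        _ ≤ (K * 2 ^ (m + 1)) * 2 ^ (J.card - m) := by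
            refine mul_le_mul_of_nonneg_right (hPQ.trans ?_) (by positivity)
            gcongr
        _ = 2 * K * (2 ^ m * 2 ^ (J.card - m)) := by ring
        _ = 2 * K * 2 ^ J.card := by rw [← pow_add, Nat.add_sub_cancel' hmJ]
        _ ≤ 2 * K * (K ^ 45 * P.card) := by gcongr
        _ = P.card * (2 * K ^ 46) := by ring
    · rw [coordSubspace, Fintype.mem_piFinset]
      intro i
      by_cases hi : i ∈ J \ J'
      · rw [if_pos hi]
        exact Finset.mem_univ _
      · rw [if_neg hi, Finset.piecewise_eq_of_notMem _ _ _ hi]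
        exact Finset.mem_singleton_self _
    · intro i hi
      by_cases hiJ : i ∈ J <;> simp [Finset.piecewise, hi, hiJ, hself]
end
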